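/- arXiv:1409.3892 — 6 statements merged into one kernel-verified Lean document; each statement's English description precedes it below -/
import Mathlib

section
/- Let G be a connected thick weakly modular graph containing no induced K_4^- and no isometric K_{3,3}^-. Then for every pair of vertices u,v with d(u,v) = 2 there exists a gated set A of G with u,v ∈ A such that d(x,y) ≤ 2 for all x,y ∈ A; consequently, the smallest gated set containing u and v has diameter 2. -/
variable {V : Type*}

/-- Triangle condition (TC). -/
def TriangleCondition (G : SimpleGraph V) : Prop :=
  ∀ u v w : V, G.Adj v w → G.dist u v = G.dist u w → 1 ≤ G.dist u v →
    ∃ x : V, G.Adj v x ∧ G.Adj w x ∧ G.dist u x + 1 = G.dist u v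

/-- Quadrangle condition (QC). -/
def QuadrangleCondition (G : SimpleGraph V) : Prop :=
  ∀ u v w z : V, G.Adj z v → G.Adj z w → G.dist v w = 2 →
    G.dist u v = G.dist u w → G.dist u z = G.dist u v + 1 →
    ∃ x : V, G.Adj v x ∧ G.Adj w x ∧ G.dist u x + 1 = G.dist u v

def WeaklyModular (G : SimpleGraph V) : Prop :=
  TriangleCondition G ∧ QuadrangleCondition G

/-- The metric interval `I(u,v)`. -/
def gInterval (G : SimpleGraph V) (u v : V) : Set V :=
  {x : V | G.dist u x + G.dist x v = G.dist u v}

/-- `G` contains an induced `K₄` minus an edge. -/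
def HasInducedK4minus (G : SimpleGraph V) : Prop :=
  ∃ a b c d : V, G.Adj a b ∧ G.Adj a c ∧ G.Adj a d ∧ G.Adj b c ∧ G.Adj b d ∧
    c ≠ d ∧ ¬ G.Adj c d

/-- `G` contains an isometric `K₃,₃` minus an edge. -/
def HasIsometricK33minus (G : SimpleGraph V) : Prop :=
  ∃ a₁ a₂ a₃ b₁ b₂ b₃ : V,
    G.Adj a₁ b₁ ∧ G.Adj a₁ b₂ ∧ G.Adj a₁ b₃ ∧
    G.Adj a₂ b₁ ∧ G.Adj a₂ b₂ ∧ G.Adj a₂ b₃ ∧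
    G.Adj a₃ b₁ ∧ G.Adj a₃ b₂ ∧
    G.dist a₁ a₂ = 2 ∧ G.dist a₁ a₃ = 2 ∧ G.dist a₂ a₃ = 2 ∧
    G.dist b₁ b₂ = 2 ∧ G.dist b₁ b₃ = 2 ∧ G.dist b₂ b₃ = 2 ∧
    G.dist a₃ b₃ = 3

/-- Induced 4-cycle `(a,b,c,d)`. -/
def InducedSquare (G : SimpleGraph V) (a b c d : V) : Prop :=
  G.Adj a b ∧ G.Adj b c ∧ G.Adj c d ∧ G.Adj d a ∧
    a ≠ c ∧ b ≠ d ∧ ¬ G.Adj a c ∧ ¬ G.Adj b d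

/-- A graph is thick if every interval between vertices at distance 2 contains
four vertices inducing a 4-cycle. -/
def Thick (G : SimpleGraph V) : Prop :=
  ∀ u v : V, G.dist u v = 2 →
    ∃ a b c d : V, a ∈ gInterval G u v ∧ b ∈ gInterval G u v ∧
      c ∈ gInterval G u v ∧ d ∈ gInterval G u v ∧ InducedSquare G a b c d

/-- A set of vertices is gated if every vertex has a gate in it. -/
def Gated (G : SimpleGraph V) (A : Set V) : Prop :=
  ∀ x : V, ∃ g ∈ A, ∀ y ∈ A, G.dist x y = G.dist x g + G.dist g y

namespace SimpleGraph

/-- A 4-cycle both of whose diagonals have length two. -/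
structure IsSquare (G : SimpleGraph V) (a b c d : V) : Prop where
  ab : G.Adj a b
  bc : G.Adj b c
  cd : G.Adj c d
  da : G.Adj d a
  ac : G.dist a c = 2
  bd : G.dist b d = 2

/-- The vertices at distance at most two from each of four given vertices. -/
def quad (G : SimpleGraph V) (a b c d : V) : Set V :=
  {x | G.dist x a ≤ 2 ∧ G.dist x b ≤ 2 ∧ G.dist x c ≤ 2 ∧ G.dist x d ≤ 2}

variable {G : SimpleGraph V}

theorem IsSquare.rotate {a b c d : V} (h : G.IsSquare a b c d) : G.IsSquare b c d a :=
  ⟨h.bc, h.cd, h.da, h.ab, h.bd, by rw [dist_comm]; exact h.ac⟩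

theorem IsSquare.reflect {a b c d : V} (h : G.IsSquare a b c d) : G.IsSquare a d c b :=
  ⟨h.da.symm, h.cd.symm, h.bc.symm, h.ab.symm, h.ac, by rw [dist_comm]; exact h.bd⟩

theorem dist_le_two_of_adj_adj {a b c : V} (hab : G.Adj a b) (hbc : G.Adj b c) :
    G.dist a c ≤ 2 :=
  dist_le (Walk.cons hab (Walk.cons hbc Walk.nil))

theorem not_adj_of_dist_eq_two {a b : V} (h : G.dist a b = 2) : ¬ G.Adj a b := by
  intro hab
  have := dist_eq_one_iff_adj.2 hab
  omega

theorem ne_of_dist_eq_two {a b : V} (h : G.dist a b = 2) : a ≠ b := by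
  rintro rfl
  simp at h

theorem Connected.dist_eq_two_of_le (hconn : G.Connected) {a b : V} (h : G.dist a b ≤ 2)
    (hne : a ≠ b) (hadj : ¬ G.Adj a b) : G.dist a b = 2 := by
  have h1 := hconn.pos_dist_of_ne hne
  have h2 : G.dist a b ≠ 1 := fun h => hadj (dist_eq_one_iff_adj.1 h)
  omega

theorem Connected.exists_adj_adj_of_dist_eq_two (hconn : G.Connected) {a b : V}
    (h : G.dist a b = 2) : ∃ p, G.Adj a p ∧ G.Adj p b := by
  obtain ⟨w, hw⟩ := hconn.exists_walk_length_eq_dist a b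
  rw [h] at hw
  obtain ⟨p, hap, hbp⟩ := G.walkLengthTwoEquivCommonNeighbors a b ⟨w, hw⟩
  exact ⟨p, hap, hbp.symm⟩

theorem adj_of_not_hasInducedK4minus (h4 : ¬ HasInducedK4minus G) {p q r s : V}
    (hpq : G.Adj p q) (hpr : G.Adj p r) (hqr : G.Adj q r) (hps : G.Adj p s) (hqs : G.Adj q s)
    (hne : r ≠ s) : G.Adj r s := by
  by_contra h
  exact h4 ⟨p, q, r, s, hpq, hpr, hps, hqr, hqs, hne, h⟩

theorem exists_adj_of_dist_eq_two (ht : TriangleCondition G) {y p q : V}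
    (hpq : G.Adj p q) (hp : G.dist y p = 2) (hq : G.dist y q = 2) :
    ∃ z, G.Adj p z ∧ G.Adj q z ∧ G.Adj y z := by
  obtain ⟨z, h1, h2, h3⟩ := ht y p q hpq (by omega) (by omega)
  exact ⟨z, h1, h2, dist_eq_one_iff_adj.1 (by omega)⟩

theorem Connected.dist_le_two_of_triangle (hconn : G.Connected) (ht : TriangleCondition G)
    (h4 : ¬ HasInducedK4minus G) {y p q r : V} (hpq : G.Adj p q) (hpr : G.Adj p r)
    (hqr : G.Adj q r) (hp : G.dist y p ≤ 2) (hq : G.dist y q ≤ 2) : G.dist y r ≤ 2 := by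
  by_contra h
  have h1 := hconn.dist_triangle (u := y) (v := p) (w := r)
  have h2 := hconn.dist_triangle (u := y) (v := q) (w := r)
  rw [dist_eq_one_iff_adj.2 hpr] at h1
  rw [dist_eq_one_iff_adj.2 hqr] at h2
  obtain ⟨z, hpz, hqz, hyz⟩ :=
    exists_adj_of_dist_eq_two ht hpq (by omega : G.dist y p = 2) (by omega)
  by_cases hzr : z = r
  · subst hzr
    rw [dist_eq_one_iff_adj.2 hyz] at h
    omega
  · exact h (dist_le_two_of_adj_adj hyz
      (adj_of_not_hasInducedK4minus h4 hpq hpz hqz hpr hqr hzr))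

/-- No vertex is adjacent to three consecutive vertices of a square. -/
theorem IsSquare.not_adj (h4 : ¬ HasInducedK4minus G) {a b c d p : V} (h : G.IsSquare a b c d)
    (hpa : G.Adj p a) (hpb : G.Adj p b) : ¬ G.Adj p c := fun hpc =>
  not_adj_of_dist_eq_two h.ac
    (adj_of_not_hasInducedK4minus h4 hpb hpa h.ab.symm hpc h.bc (ne_of_dist_eq_two h.ac))

/-- A vertex completing one side of a square to a triangle extends to a parallel square. -/
theorem IsSquare.exists_parallel (hconn : G.Connected) (ht : TriangleCondition G)
    (h4 : ¬ HasInducedK4minus G) {a b c d p : V} (h : G.IsSquare a b c d)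
    (hpa : G.Adj p a) (hpb : G.Adj p b) :
    ∃ r, G.Adj c r ∧ G.Adj d r ∧ G.IsSquare a p r d := by
  have hac := not_adj_of_dist_eq_two h.ac
  have hbd := not_adj_of_dist_eq_two h.bd
  have hpc : G.dist p c = 2 := hconn.dist_eq_two_of_le (dist_le_two_of_adj_adj hpb h.bc)
    (by rintro rfl; exact hac hpa.symm) (h.not_adj h4 hpa hpb)
  have hpd : G.dist p d = 2 := hconn.dist_eq_two_of_le (dist_le_two_of_adj_adj hpa h.da.symm)
    (by rintro rfl; exact hbd hpb.symm) (h.rotate.reflect.not_adj h4 hpb hpa)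
  obtain ⟨r, hcr, hdr, hpr⟩ := exists_adj_of_dist_eq_two ht h.cd hpc hpd
  refine ⟨r, hcr, hdr, hpa.symm, hpr, hdr.symm, h.da, ?_, hpd⟩
  refine hconn.dist_eq_two_of_le (dist_le_two_of_adj_adj hpa.symm hpr)
    (by rintro rfl; exact hac hcr.symm) fun har => hac ?_
  exact adj_of_not_hasInducedK4minus h4 hdr h.da har.symm h.cd.symm hcr.symm
    (ne_of_dist_eq_two h.ac)

theorem quad_rotate {a b c d x : V} (hx : x ∈ G.quad a b c d) : x ∈ G.quad b c d a :=
  ⟨hx.2.1, hx.2.2.1, hx.2.2.2, hx.1⟩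

theorem quad_rotate_eq (a b c d : V) : G.quad a b c d = G.quad b c d a :=
  Set.ext fun _ => ⟨quad_rotate, fun hx => quad_rotate <| quad_rotate <| quad_rotate hx⟩

theorem IsSquare.fst_mem_quad {a b c d : V} (h : G.IsSquare a b c d) : a ∈ G.quad a b c d :=
  ⟨by simp, by simp [dist_eq_one_iff_adj.2 h.ab], h.ac.le,
    by simp [dist_eq_one_iff_adj.2 h.da.symm]⟩

theorem IsSquare.snd_mem_quad {a b c d : V} (h : G.IsSquare a b c d) : b ∈ G.quad a b c d :=
  quad_rotate <| quad_rotate <| quad_rotate h.rotate.fst_mem_quad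

theorem IsSquare.trd_mem_quad {a b c d : V} (h : G.IsSquare a b c d) : c ∈ G.quad a b c d :=
  quad_rotate <| quad_rotate h.rotate.rotate.fst_mem_quad

theorem IsSquare.fth_mem_quad {a b c d : V} (h : G.IsSquare a b c d) : d ∈ G.quad a b c d :=
  quad_rotate h.rotate.rotate.rotate.fst_mem_quad

theorem IsSquare.mem_quad_of_opposite {a b c d x : V} (h : G.IsSquare a b c d)
    (hxa : G.Adj x a) (hxc : G.Adj x c) : x ∈ G.quad a b c d :=
  ⟨by simp [dist_eq_one_iff_adj.2 hxa], dist_le_two_of_adj_adj hxa h.ab,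
    by simp [dist_eq_one_iff_adj.2 hxc], dist_le_two_of_adj_adj hxa h.da.symm⟩

theorem Connected.mem_quad_of_triangle (hconn : G.Connected) (ht : TriangleCondition G)
    (h4 : ¬ HasInducedK4minus G) {a b c d p q r : V} (hpq : G.Adj p q) (hpr : G.Adj p r)
    (hqr : G.Adj q r) (hp : p ∈ G.quad a b c d) (hq : q ∈ G.quad a b c d) :
    r ∈ G.quad a b c d := by
  have key (e : V) (h1 : G.dist p e ≤ 2) (h2 : G.dist q e ≤ 2) : G.dist r e ≤ 2 := by
    rw [dist_comm] at h1 h2 ⊢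
    exact hconn.dist_le_two_of_triangle ht h4 hpq hpr hqr h1 h2
  exact ⟨key a hp.1 hq.1, key b hp.2.1 hq.2.1, key c hp.2.2.1 hq.2.2.1,
    key d hp.2.2.2 hq.2.2.2⟩

/-- Passing to a parallel square can only enlarge the quad. -/
theorem Connected.quad_subset_parallel (hconn : G.Connected) (ht : TriangleCondition G)
    (h4 : ¬ HasInducedK4minus G) {a b c d p r x : V} (h : G.IsSquare a b c d)
    (hpa : G.Adj p a) (hpb : G.Adj p b) (hcr : G.Adj c r) (hdr : G.Adj d r)
    (hx : x ∈ G.quad a b c d) : x ∈ G.quad a p r d :=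
  ⟨hx.1, hconn.dist_le_two_of_triangle ht h4 h.ab hpa.symm hpb.symm hx.1 hx.2.1,
    hconn.dist_le_two_of_triangle ht h4 h.cd hcr hdr hx.2.2.1 hx.2.2.2, hx.2.2.2⟩

theorem IsSquare.dist_le_two_of_dist_eq_two (hconn : G.Connected) (ht : TriangleCondition G)
    (h4 : ¬ HasInducedK4minus G) {a b c d x y : V} (h : G.IsSquare a b c d)
    (hxa : G.Adj x a) (hxc : G.Adj x c) (hya : G.dist y a = 2) (hyb : G.dist y b = 2)
    (hyc : G.dist y c = 2) : G.dist y x ≤ 2 := by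
  by_cases hxb : x = b
  · rw [hxb, hyb]
  have hbx : G.dist b x = 2 := hconn.dist_eq_two_of_le
    (dist_le_two_of_adj_adj h.ab.symm hxa.symm) (Ne.symm hxb)
    fun hbx => h.not_adj h4 hxa hbx.symm hxc
  obtain ⟨p, hap, hbp, hyp⟩ := exists_adj_of_dist_eq_two ht h.ab hya hyb
  have hs : G.IsSquare a b c x := ⟨h.ab, h.bc, hxc.symm, hxa, h.ac, hbx⟩
  obtain ⟨r, hcr, hxr, hs'⟩ := hs.exists_parallel hconn ht h4 hap.symm hbp.symm
  exact hconn.dist_le_two_of_triangle ht h4 hcr hxc.symm hxr.symm hyc.le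
    (dist_le_two_of_adj_adj hyp hs'.bc)

theorem IsSquare.dist_le_two_of_opposite (hconn : G.Connected) (ht : TriangleCondition G)
    (h4 : ¬ HasInducedK4minus G) (h33 : ¬ HasIsometricK33minus G) {a b c d x y : V}
    (h : G.IsSquare a b c d) (hxa : G.Adj x a) (hxc : G.Adj x c) (hy : y ∈ G.quad a b c d) :
    G.dist y x ≤ 2 := by
  by_contra hyx
  have h1 := hconn.dist_triangle (u := y) (v := a) (w := x)
  have h2 := hconn.dist_triangle (u := y) (v := c) (w := x)
  rw [dist_eq_one_iff_adj.2 hxa.symm] at h1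
  rw [dist_eq_one_iff_adj.2 hxc.symm] at h2
  obtain ⟨hya, hyb, hyc, hyd⟩ := hy
  have key (b d : V) (h : G.IsSquare a b c d) (hyb : G.dist y b ≤ 2) :
      G.Adj y b ∧ G.dist x b = 2 := by
    have hbx : G.dist x b ≤ 2 := dist_le_two_of_adj_adj hxa h.ab
    constructor
    · by_contra hadj
      refine hyx (h.dist_le_two_of_dist_eq_two hconn ht h4 hxa hxc (by omega)
        (hconn.dist_eq_two_of_le hyb ?_ hadj) (by omega))
      rintro rfl
      rw [dist_comm] at hbx
      exact hyx hbx
    · refine hconn.dist_eq_two_of_le hbx ?_ fun hbx => h.not_adj h4 hxa hbx hxc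
      rintro rfl
      exact hyx hyb
  obtain ⟨hyb', hxb⟩ := key b d h hyb
  obtain ⟨hyd', hxd⟩ := key d b h.reflect hyd
  refine h33 ⟨b, d, x, a, c, y, h.ab.symm, h.bc, hyb'.symm, h.da, h.cd.symm, hyd'.symm,
    hxa, hxc, h.bd, ?_, ?_, h.ac, ?_, ?_, ?_⟩ <;> rw [dist_comm] <;> omega

theorem IsSquare.dist_le_two_of_adj (hconn : G.Connected) (ht : TriangleCondition G)
    (h4 : ¬ HasInducedK4minus G) (h33 : ¬ HasIsometricK33minus G) {a b c d x y : V}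
    (h : G.IsSquare a b c d) (hxa : G.Adj x a) (hx : x ∈ G.quad a b c d)
    (hy : y ∈ G.quad a b c d) : G.dist y x ≤ 2 := by
  by_cases hxb : G.Adj x b
  · exact hconn.dist_le_two_of_triangle ht h4 h.ab hxa.symm hxb.symm hy.1 hy.2.1
  by_cases hxc : G.Adj x c
  · exact h.dist_le_two_of_opposite hconn ht h4 h33 hxa hxc hy
  by_cases hb : x = b
  · exact hb ▸ hy.2.1
  by_cases hc : x = c
  · exact hc ▸ hy.2.2.1
  obtain ⟨p, hbp, hcp, hxp⟩ := exists_adj_of_dist_eq_two ht h.bc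
    (hconn.dist_eq_two_of_le hx.2.1 hb hxb) (hconn.dist_eq_two_of_le hx.2.2.1 hc hxc)
  obtain ⟨r, hdr, har, hs⟩ := h.rotate.exists_parallel hconn ht h4 hbp.symm hcp.symm
  exact hs.rotate.rotate.rotate.dist_le_two_of_opposite hconn ht h4 h33 hxa hxp
    (quad_rotate <| quad_rotate <| quad_rotate <|
      hconn.quad_subset_parallel ht h4 h.rotate hbp.symm hcp.symm hdr har (quad_rotate hy))

theorem IsSquare.dist_le_two (hconn : G.Connected) (ht : TriangleCondition G)
    (h4 : ¬ HasInducedK4minus G) (h33 : ¬ HasIsometricK33minus G) {a b c d x y : V}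
    (h : G.IsSquare a b c d) (hx : x ∈ G.quad a b c d) (hy : y ∈ G.quad a b c d) :
    G.dist y x ≤ 2 := by
  by_cases ha : x = a
  · exact ha ▸ hy.1
  by_cases hb : x = b
  · exact hb ▸ hy.2.1
  by_cases hxa : G.Adj x a
  · exact h.dist_le_two_of_adj hconn ht h4 h33 hxa hx hy
  by_cases hxb : G.Adj x b
  · exact h.rotate.dist_le_two_of_adj hconn ht h4 h33 hxb (quad_rotate hx) (quad_rotate hy)
  obtain ⟨p, hap, hbp, hxp⟩ := exists_adj_of_dist_eq_two ht h.ab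
    (hconn.dist_eq_two_of_le hx.1 ha hxa) (hconn.dist_eq_two_of_le hx.2.1 hb hxb)
  obtain ⟨r, hcr, hdr, hs⟩ := h.exists_parallel hconn ht h4 hap.symm hbp.symm
  have key {z : V} (hz : z ∈ G.quad a b c d) : z ∈ G.quad p r d a :=
    quad_rotate (hconn.quad_subset_parallel ht h4 h hap.symm hbp.symm hcr hdr hz)
  exact hs.rotate.dist_le_two_of_adj hconn ht h4 h33 hxp (key hx) (key hy)

/-- A square contained in the quad of another square spans the same quad. -/
theorem IsSquare.quad_eq (hconn : G.Connected) (ht : TriangleCondition G)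
    (h4 : ¬ HasInducedK4minus G) (h33 : ¬ HasIsometricK33minus G) {a b c d a' b' c' d' : V}
    (h : G.IsSquare a b c d) (h' : G.IsSquare a' b' c' d') (ha : a' ∈ G.quad a b c d)
    (hb : b' ∈ G.quad a b c d) (hc : c' ∈ G.quad a b c d) (hd : d' ∈ G.quad a b c d) :
    G.quad a b c d = G.quad a' b' c' d' := by
  have sub {z : V} (hz : z ∈ G.quad a b c d) : z ∈ G.quad a' b' c' d' :=
    ⟨h.dist_le_two hconn ht h4 h33 ha hz, h.dist_le_two hconn ht h4 h33 hb hz,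
      h.dist_le_two hconn ht h4 h33 hc hz, h.dist_le_two hconn ht h4 h33 hd hz⟩
  have ha' := sub h.fst_mem_quad
  have hb' := sub h.snd_mem_quad
  have hc' := sub h.trd_mem_quad
  have hd' := sub h.fth_mem_quad
  exact Set.Subset.antisymm (fun z hz => sub hz) fun z hz =>
    ⟨h'.dist_le_two hconn ht h4 h33 ha' hz, h'.dist_le_two hconn ht h4 h33 hb' hz,
      h'.dist_le_two hconn ht h4 h33 hc' hz, h'.dist_le_two hconn ht h4 h33 hd' hz⟩

/-- A vertex of a quad adjacent to a vertex of the defining square lies on a square spanning the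
same quad. -/
theorem IsSquare.exists_square_of_adj (hconn : G.Connected) (ht : TriangleCondition G)
    (h4 : ¬ HasInducedK4minus G) (h33 : ¬ HasIsometricK33minus G) {a b c d x : V}
    (h : G.IsSquare a b c d) (hxa : G.Adj x a) (hx : x ∈ G.quad a b c d) :
    ∃ p q r, G.IsSquare x p q r ∧ G.quad a b c d = G.quad x p q r := by
  by_cases hb : x = b
  · subst hb
    exact ⟨c, d, a, h.rotate, quad_rotate_eq _ _ _ _⟩
  by_cases hxb : G.Adj x b
  · obtain ⟨r, hcr, hdr, hs⟩ := h.exists_parallel hconn ht h4 hxa hxb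
    have hr : r ∈ G.quad a b c d := hconn.mem_quad_of_triangle ht h4 h.cd hcr hdr
      h.trd_mem_quad h.fth_mem_quad
    exact ⟨r, d, a, hs.rotate, h.quad_eq hconn ht h4 h33 hs.rotate hx hr h.fth_mem_quad
      h.fst_mem_quad⟩
  have hxb2 := hconn.dist_eq_two_of_le hx.2.1 hb hxb
  by_cases hxc : G.Adj x c
  · have hs : G.IsSquare x a b c := ⟨hxa, h.ab, h.bc, hxc.symm, hxb2, h.ac⟩
    exact ⟨a, b, c, hs, h.quad_eq hconn ht h4 h33 hs hx h.fst_mem_quad h.snd_mem_quad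
      h.trd_mem_quad⟩
  have hxc2 := hconn.dist_eq_two_of_le hx.2.2.1
    (by rintro rfl; exact not_adj_of_dist_eq_two h.ac hxa.symm) hxc
  obtain ⟨p, hbp, hcp, hxp⟩ := exists_adj_of_dist_eq_two ht h.bc hxb2 hxc2
  have hp : p ∈ G.quad a b c d := hconn.mem_quad_of_triangle ht h4 h.bc hbp hcp
    h.snd_mem_quad h.trd_mem_quad
  have hs : G.IsSquare x a b p := ⟨hxa, h.ab, hbp, hxp.symm, hxb2, by
    refine hconn.dist_eq_two_of_le (dist_le_two_of_adj_adj h.ab hbp) ?_ ?_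
    · rintro rfl
      exact not_adj_of_dist_eq_two h.ac hcp.symm
    · intro hap
      exact h.not_adj h4 hap.symm hbp.symm hcp.symm⟩
  exact ⟨a, b, p, hs, h.quad_eq hconn ht h4 h33 hs hx h.fst_mem_quad h.snd_mem_quad hp⟩

theorem IsSquare.exists_square (hconn : G.Connected) (ht : TriangleCondition G)
    (h4 : ¬ HasInducedK4minus G) (h33 : ¬ HasIsometricK33minus G) {a b c d x : V}
    (h : G.IsSquare a b c d) (hx : x ∈ G.quad a b c d) :
    ∃ p q r, G.IsSquare x p q r ∧ G.quad a b c d = G.quad x p q r := by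
  by_cases ha : x = a
  · subst ha
    exact ⟨b, c, d, h, rfl⟩
  by_cases hxa : G.Adj x a
  · exact h.exists_square_of_adj hconn ht h4 h33 hxa hx
  by_cases hb : x = b
  · subst hb
    exact ⟨c, d, a, h.rotate, quad_rotate_eq _ _ _ _⟩
  by_cases hxb : G.Adj x b
  · rw [quad_rotate_eq] at hx ⊢
    exact h.rotate.exists_square_of_adj hconn ht h4 h33 hxb hx
  obtain ⟨p, hap, hbp, hxp⟩ := exists_adj_of_dist_eq_two ht h.ab
    (hconn.dist_eq_two_of_le hx.1 ha hxa) (hconn.dist_eq_two_of_le hx.2.1 hb hxb)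
  obtain ⟨r, hcr, hdr, hs⟩ := h.exists_parallel hconn ht h4 hap.symm hbp.symm
  have hp : p ∈ G.quad a b c d := hconn.mem_quad_of_triangle ht h4 h.ab hap hbp
    h.fst_mem_quad h.snd_mem_quad
  have hr : r ∈ G.quad a b c d := hconn.mem_quad_of_triangle ht h4 h.cd hcr hdr
    h.trd_mem_quad h.fth_mem_quad
  have heq := h.quad_eq hconn ht h4 h33 hs.rotate hp hr h.fth_mem_quad h.fst_mem_quad
  rw [heq] at hx ⊢
  exact hs.rotate.exists_square_of_adj hconn ht h4 h33 hxp hx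

/-- Two vertices of a quad at distance two are opposite in a square spanning the quad. -/
theorem IsSquare.exists_square_opposite (hconn : G.Connected) (ht : TriangleCondition G)
    (h4 : ¬ HasInducedK4minus G) (h33 : ¬ HasIsometricK33minus G) {a b c d x y : V}
    (h : G.IsSquare a b c d) (hx : x ∈ G.quad a b c d) (hy : y ∈ G.quad a b c d)
    (hxy : G.dist x y = 2) :
    ∃ p q, G.IsSquare x p y q ∧ G.quad a b c d = G.quad x p y q := by
  obtain ⟨b, c, d, hs, heq⟩ := h.exists_square hconn ht h4 h33 hx
  rw [heq] at hy ⊢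
  have hyx : G.dist y x = 2 := by rw [dist_comm]; exact hxy
  have key (e : V) (hxe : G.Adj x e) (hye : G.dist y e ≤ 2) :
      ∃ p, G.Adj x p ∧ G.Adj y p ∧ (p = e ∨ G.Adj e p) := by
    by_cases hadj : G.Adj y e
    · exact ⟨e, hxe, hadj, Or.inl rfl⟩
    · obtain ⟨p, h1, h2, h3⟩ := exists_adj_of_dist_eq_two ht hxe hyx
        (hconn.dist_eq_two_of_le hye
          (by rintro rfl; exact not_adj_of_dist_eq_two hxy hxe) hadj)
      exact ⟨p, h1, h3, Or.inr h2⟩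
  obtain ⟨p, hxp, hyp, hp⟩ := key b hs.ab hy.2.1
  obtain ⟨q, hxq, hyq, hq⟩ := key d hs.da.symm hy.2.2.2
  have hbd := not_adj_of_dist_eq_two hs.bd
  have hbd' := ne_of_dist_eq_two hs.bd
  have hpd : ¬ (p = d ∨ G.Adj d p) := by
    rintro (rfl | hdp)
    · rcases hp with rfl | hp
      exacts [hbd' rfl, hbd hp]
    · rcases hp with rfl | hp
      · exact hbd hdp.symm
      · exact hbd (adj_of_not_hasInducedK4minus h4 hxp hs.ab hp.symm hs.da.symm hdp.symm hbd')
  have hpq : ¬ G.Adj p q := by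
    rcases hq with rfl | hq
    · exact fun hpq => hpd (Or.inr hpq.symm)
    · intro hpq
      refine hpd (Or.inr (adj_of_not_hasInducedK4minus h4 hxq hs.da.symm hq.symm hxp hpq.symm ?_))
      rintro rfl
      exact hpd (Or.inl rfl)
  have hpq' : p ≠ q := by
    rintro rfl
    exact hpd hq
  have hs' : G.IsSquare x p y q := ⟨hxp, hyp.symm, hyq, hxq.symm, hxy,
    hconn.dist_eq_two_of_le (dist_le_two_of_adj_adj hxp.symm hxq) hpq' hpq⟩
  have mem (e p : V) (hxe : G.Adj x e) (hxp : G.Adj x p) (he : e ∈ G.quad x b c d)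
      (hp : p = e ∨ G.Adj e p) : p ∈ G.quad x b c d := by
    rcases hp with rfl | hp
    · exact he
    · exact hconn.mem_quad_of_triangle ht h4 hxe hxp hp hs.fst_mem_quad he
  exact ⟨p, q, hs', hs.quad_eq hconn ht h4 h33 hs' hs.fst_mem_quad
    (mem b p hs.ab hxp hs.snd_mem_quad hp) hy (mem d q hs.da.symm hxq hs.fth_mem_quad hq)⟩

theorem IsSquare.mem_quad_of_adj_adj (hconn : G.Connected) (ht : TriangleCondition G)
    (h4 : ¬ HasInducedK4minus G) (h33 : ¬ HasIsometricK33minus G) {a b c d x y z : V}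
    (h : G.IsSquare a b c d) (hx : x ∈ G.quad a b c d) (hy : y ∈ G.quad a b c d)
    (hxy : x ≠ y) (hzx : G.Adj z x) (hzy : G.Adj z y) : z ∈ G.quad a b c d := by
  by_cases hadj : G.Adj x y
  · exact hconn.mem_quad_of_triangle ht h4 hadj hzx.symm hzy.symm hx hy
  obtain ⟨p, q, hs, heq⟩ := h.exists_square_opposite hconn ht h4 h33 hx hy
    (hconn.dist_eq_two_of_le (dist_le_two_of_adj_adj hzx.symm hzy) hxy hadj)
  rw [heq]
  exact hs.mem_quad_of_opposite hzx hzy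

end SimpleGraph

/-- In a weakly modular graph, a nonempty set of diameter at most two which contains every vertex
having two neighbors in it is gated. -/
theorem WeaklyModular.gated_of_closed {G : SimpleGraph V} (hconn : G.Connected)
    (hwm : WeaklyModular G) {A : Set V} (hne : A.Nonempty)
    (hdiam : ∀ x ∈ A, ∀ y ∈ A, G.dist x y ≤ 2)
    (hclosed : ∀ x ∈ A, ∀ y ∈ A, ∀ z, x ≠ y → G.Adj z x → G.Adj z y → z ∈ A) :
    Gated G A := by
  intro x
  obtain ⟨g₀, hg₀, hmin⟩ : ∃ g ∈ A, ∀ y ∈ A, G.dist x g ≤ G.dist x y :=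
    ⟨_, Function.argminOn_mem (G.dist x) A hne, fun _ hy => Function.argminOn_le (G.dist x) A hy⟩
  have hadj {g y : V} (hg : g ∈ A) (hy : y ∈ A) (hgx : G.dist x g = G.dist x g₀)
      (hgy : G.Adj g y) : G.dist x y = G.dist x g₀ + 1 := by
    have h1 := hconn.dist_triangle (u := x) (v := g) (w := y)
    rw [SimpleGraph.dist_eq_one_iff_adj.2 hgy] at h1
    have h2 := hmin y hy
    by_contra h
    have heq : G.dist x g = G.dist x y := by omega
    rcases Nat.eq_zero_or_pos (G.dist x g) with h0 | h0
    · exact hgy.ne ((hconn.dist_eq_zero_iff.1 h0).symm.trans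
        (hconn.dist_eq_zero_iff.1 (heq ▸ h0)))
    · obtain ⟨z, hgz, hyz, hz⟩ := hwm.1 x g y hgy heq h0
      have := hmin z (hclosed g hg y hy z hgy.ne hgz.symm hyz.symm)
      omega
  have htwo {g y : V} (hg : g ∈ A) (hy : y ∈ A) (hgx : G.dist x g = G.dist x g₀)
      (hgy : G.dist g y = 2) : G.dist x y ≠ G.dist x g₀ := by
    intro heq
    obtain ⟨p, hgp, hpy⟩ := hconn.exists_adj_adj_of_dist_eq_two hgy
    have hp := hclosed g hg y hy p (SimpleGraph.ne_of_dist_eq_two hgy) hgp.symm hpy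
    have hpx := hadj hg hp hgx hgp
    obtain ⟨z, hgz, hyz, hz⟩ :=
      hwm.2 x g y p hgp.symm hpy hgy (hgx.trans heq.symm) (by omega)
    have := hmin z (hclosed g hg y hy z (SimpleGraph.ne_of_dist_eq_two hgy) hgz.symm hyz.symm)
    omega
  refine ⟨g₀, hg₀, fun y hy => ?_⟩
  by_cases h0 : g₀ = y
  · simp [h0]
  by_cases h1 : G.Adj g₀ y
  · rw [hadj hg₀ hy rfl h1, SimpleGraph.dist_eq_one_iff_adj.2 h1]
  have h2 := hconn.dist_eq_two_of_le (hdiam g₀ hg₀ y hy) h0 h1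
  obtain ⟨p, hgp, hpy⟩ := hconn.exists_adj_adj_of_dist_eq_two h2
  have hp := hclosed g₀ hg₀ y hy p h0 hgp.symm hpy
  have hpx := hadj hg₀ hp rfl hgp
  have h3 := hconn.dist_triangle (u := x) (v := g₀) (w := y)
  have h4 := hmin y hy
  have h5 := htwo hg₀ hy rfl h2
  by_contra h
  obtain ⟨z, hpz, hyz, hz⟩ := hwm.1 x p y hpy (by omega) (by omega)
  have hzA := hclosed p hp y hy z hpy.ne hpz.symm hyz.symm
  have hzx : G.dist x z = G.dist x g₀ := by omega
  have hgz : g₀ ≠ z := by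
    rintro rfl
    exact h1 hyz.symm
  have hgz' : ¬ G.Adj g₀ z := fun hgz => by
    have := hadj hg₀ hzA rfl hgz
    omega
  exact htwo hg₀ hzA rfl (hconn.dist_eq_two_of_le (hdiam g₀ hg₀ z hzA) hgz hgz') hzx

/-- In a thick graph without induced `K₄` minus an edge, vertices at distance two are opposite in
some square. -/
theorem Thick.exists_isSquare {G : SimpleGraph V} (hconn : G.Connected) (hthick : Thick G)
    (h4 : ¬ HasInducedK4minus G) {u v : V} (hd : G.dist u v = 2) :
    ∃ p q, G.IsSquare u p v q := by
  obtain ⟨a, b, c, d, ha, hb, hc, hd', hab, hbc, hcd, hda, hac, hbd, hac', hbd'⟩ := hthick u v hd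
  have mem {x : V} (hx : x ∈ gInterval G u v) : x = u ∨ x = v ∨ G.Adj u x ∧ G.Adj v x := by
    have hx' : G.dist u x + G.dist x v = 2 := hd ▸ hx
    by_cases h0 : G.dist u x = 0
    · exact Or.inl (hconn.dist_eq_zero_iff.1 h0).symm
    by_cases h1 : G.dist x v = 0
    · exact Or.inr (Or.inl (hconn.dist_eq_zero_iff.1 h1))
    · exact Or.inr (Or.inr ⟨SimpleGraph.dist_eq_one_iff_adj.1 (by omega),
        (SimpleGraph.dist_eq_one_iff_adj.1 (by omega)).symm⟩)
  have huv := SimpleGraph.not_adj_of_dist_eq_two hd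
  have huv' := SimpleGraph.ne_of_dist_eq_two hd
  have build {p q : V} (hp : G.Adj u p ∧ G.Adj v p) (hq : G.Adj u q ∧ G.Adj v q) (hne : p ≠ q)
      (hpq : ¬ G.Adj p q) : ∃ p q, G.IsSquare u p v q :=
    ⟨p, q, hp.1, hp.2.symm, hq.2, hq.1.symm, hd, hconn.dist_eq_two_of_le
      (SimpleGraph.dist_le_two_of_adj_adj hp.1.symm hq.1) hne hpq⟩
  have hno {p q : V} (hp : G.Adj u p ∧ G.Adj v p) (hq : G.Adj u q ∧ G.Adj v q) :
      ¬ G.Adj p q := fun hpq => huv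
    (SimpleGraph.adj_of_not_hasInducedK4minus h4 hpq hp.1.symm hq.1.symm hp.2.symm hq.2.symm huv')
  have hend {p q : V} (hp : p = u ∨ p = v) (hq : q ∈ gInterval G u v) (hpq : G.Adj p q) :
      G.Adj u q ∧ G.Adj v q := by
    rcases mem hq with rfl | rfl | hq
    · rcases hp with rfl | rfl
      exacts [(hpq.ne rfl).elim, (huv hpq.symm).elim]
    · rcases hp with rfl | rfl
      exacts [(huv hpq).elim, (hpq.ne rfl).elim]
    · exact hq
  by_cases hau : a = u ∨ a = v
  · exact build (hend hau hb hab) (hend hau hd' hda.symm) hbd hbd'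
  by_cases hbu : b = u ∨ b = v
  · exact build (hend hbu ha hab.symm) (hend hbu hc hbc) hac hac'
  have ha' : G.Adj u a ∧ G.Adj v a := by
    have := mem ha
    tauto
  have hb' : G.Adj u b ∧ G.Adj v b := by
    have := mem hb
    tauto
  exact (hno ha' hb' hab).elim

theorem statement11 (G : SimpleGraph V) (hconn : G.Connected)
    (hwm : WeaklyModular G) (hthick : Thick G)
    (h4 : ¬ HasInducedK4minus G) (h33 : ¬ HasIsometricK33minus G)
    (u v : V) (hd : G.dist u v = 2) :
    (∃ A : Set V, Gated G A ∧ u ∈ A ∧ v ∈ A ∧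
      ∀ x ∈ A, ∀ y ∈ A, G.dist x y ≤ 2) ∧
    (∀ B : Set V, Gated G B → u ∈ B → v ∈ B →
      (∀ C : Set V, Gated G C → u ∈ C → v ∈ C → B ⊆ C) →
      (∀ x ∈ B, ∀ y ∈ B, G.dist x y ≤ 2) ∧
        ∃ x ∈ B, ∃ y ∈ B, G.dist x y = 2) := by
  obtain ⟨p, q, hs⟩ := hthick.exists_isSquare hconn h4 hd
  have hdiam : ∀ x ∈ G.quad u p v q, ∀ y ∈ G.quad u p v q, G.dist x y ≤ 2 :=
    fun x hx y hy => hs.dist_le_two hconn hwm.1 h4 h33 hy hx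
  have hgated : Gated G (G.quad u p v q) :=
    hwm.gated_of_closed hconn ⟨u, hs.fst_mem_quad⟩ hdiam fun x hx y hy z hxy hzx hzy =>
      hs.mem_quad_of_adj_adj hconn hwm.1 h4 h33 hx hy hxy hzx hzy
  refine ⟨⟨_, hgated, hs.fst_mem_quad, hs.trd_mem_quad, hdiam⟩, fun B _ hu hv hB => ?_⟩
  have hsub := hB _ hgated hs.fst_mem_quad hs.trd_mem_quad
  exact ⟨fun x hx y hy => hdiam x (hsub hx) y (hsub hy), u, hu, v, hv, hd⟩
end

section
/- Let G be a connected pre-median graph containing no induced propeller. Then G satisfies the positioning condition: for every vertex u and every induced 4-cycle (v1,v2,v3,v4) of G, d(u,v1) + d(u,v3) = d(u,v2) + d(u,v4). In particular, G contains no induced double-house. -/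
variable {V : Type*}

/-- `G` contains an induced `K₂,₃`. -/
def HasInducedK23 (G : SimpleGraph V) : Prop :=
  ∃ a b x y z : V, a ≠ b ∧ ¬ G.Adj a b ∧
    x ≠ y ∧ y ≠ z ∧ x ≠ z ∧ ¬ G.Adj x y ∧ ¬ G.Adj y z ∧ ¬ G.Adj x z ∧
    G.Adj a x ∧ G.Adj a y ∧ G.Adj a z ∧ G.Adj b x ∧ G.Adj b y ∧ G.Adj b z

/-- `G` contains an induced `W₄⁻`: an induced 4-cycle `(x₁,x₂,x₃,x₄)` together
with a vertex `c` adjacent to `x₂,x₃,x₄` but not to `x₁`. -/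
def HasInducedW4minus (G : SimpleGraph V) : Prop :=
  ∃ c x₁ x₂ x₃ x₄ : V, InducedSquare G x₁ x₂ x₃ x₄ ∧
    G.Adj c x₂ ∧ G.Adj c x₃ ∧ G.Adj c x₄ ∧ c ≠ x₁ ∧ ¬ G.Adj c x₁

/-- A pre-median graph: connected, weakly modular, with no induced `K₂,₃`
and no induced `W₄⁻`. -/
def PreMedian (G : SimpleGraph V) : Prop :=
  G.Connected ∧ WeaklyModular G ∧ ¬ HasInducedK23 G ∧ ¬ HasInducedW4minus G

/-- `G` contains an induced propeller. -/
def HasInducedPropeller (G : SimpleGraph V) : Prop :=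
  ∃ a b x y z : V, G.Adj a b ∧
    G.Adj a x ∧ G.Adj a y ∧ G.Adj a z ∧ G.Adj b x ∧ G.Adj b y ∧ G.Adj b z ∧
    x ≠ y ∧ y ≠ z ∧ x ≠ z ∧ ¬ G.Adj x y ∧ ¬ G.Adj y z ∧ ¬ G.Adj x z

/-- `G` contains an induced double-house: a triangle `u v w` together with the
two squares `(x,y,v,u)` and `(x,u,w,z)`, with edges exactly
`uv, vw, wu, xy, yv, ux, wz, zx`. -/
def HasInducedDoubleHouse (G : SimpleGraph V) : Prop :=
  ∃ x y u v w z : V,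
    G.Adj u v ∧ G.Adj v w ∧ G.Adj w u ∧ G.Adj x y ∧ G.Adj y v ∧ G.Adj u x ∧
    G.Adj w z ∧ G.Adj z x ∧
    x ≠ v ∧ x ≠ w ∧ y ≠ u ∧ y ≠ w ∧ y ≠ z ∧ u ≠ z ∧ v ≠ z ∧
    ¬ G.Adj x v ∧ ¬ G.Adj x w ∧ ¬ G.Adj y u ∧ ¬ G.Adj y w ∧ ¬ G.Adj y z ∧
    ¬ G.Adj u z ∧ ¬ G.Adj v z

namespace SimpleGraph

variable {G : SimpleGraph V}

/-- Two distinct non-adjacent vertices with a common neighbour are at distance two. -/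
theorem dist_eq_two_of_common_neighbor {a b c : V} (hne : a ≠ c) (hac : ¬ G.Adj a c)
    (hab : G.Adj a b) (hbc : G.Adj b c) : G.dist a c = 2 := by
  have hle : G.dist a c ≤ 2 := dist_le (Walk.cons hab (Walk.cons hbc Walk.nil))
  have hpos := (hab.reachable.trans hbc.reachable).pos_dist_of_ne hne
  have hone : G.dist a c ≠ 1 := fun h => hac (dist_eq_one_iff_adj.mp h)
  omega

theorem Connected.dist_le_dist_add_one_of_adj (hconn : G.Connected) (u : V) {v w : V}
    (h : G.Adj v w) : G.dist u w ≤ G.dist u v + 1 := by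
  have htri := hconn.dist_triangle (u := u) (v := v) (w := w)
  have hone := dist_eq_one_iff_adj.mpr h
  omega

end SimpleGraph

theorem InducedSquare.rotate {G : SimpleGraph V} {a b c d : V} (h : InducedSquare G a b c d) :
    InducedSquare G b c d a := by
  obtain ⟨hab, hbc, hcd, hda, hac, hbd, hnac, hnbd⟩ := h
  exact ⟨hbc, hcd, hda, hab, hbd, hac.symm, hnbd, fun h => hnac h.symm⟩

namespace PreMedian

variable {G : SimpleGraph V}

/-- A vertex adjacent to two opposite vertices of an induced square, and not on the square, is
adjacent to the whole square. -/
theorem adj_of_adj_opposite (hpm : PreMedian G) {a b c d s : V} (h : InducedSquare G a b c d)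
    (hsa : G.Adj s a) (hsc : G.Adj s c) (hsb : s ≠ b) (hsd : s ≠ d) :
    G.Adj s b ∧ G.Adj s d := by
  obtain ⟨-, -, hK, hW⟩ := hpm
  have hr := h.rotate
  have hr' := hr.rotate.rotate
  obtain ⟨hab, hbc, hcd, hda, hac, hbd, hnac, hnbd⟩ := h
  by_cases h1 : G.Adj s b <;> by_cases h2 : G.Adj s d
  · exact ⟨h1, h2⟩
  · exact (hW ⟨s, d, a, b, c, hr', hsa, h1, hsc, hsd, h2⟩).elim
  · exact (hW ⟨s, b, c, d, a, hr, hsc, h2, hsa, hsb, h1⟩).elim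
  · exact (hK ⟨a, c, b, d, s, hac, hnac, hbd, hsd.symm, hsb.symm, hnbd,
      fun h => h2 h.symm, fun h => h1 h.symm, hab, hda.symm, hsa.symm, hbc.symm, hcd,
      hsc.symm⟩).elim

theorem not_hasInducedDoubleHouse (hpm : PreMedian G) (hprop : ¬ HasInducedPropeller G) :
    ¬ HasInducedDoubleHouse G := by
  rintro ⟨x, y, u, v, w, z, huv, hvw, hwu, hxy, hyv, hux, hwz, hzx, -, hxw, hyu, hyw, hyz, huz,
    -, -, nxw, nyu, nyw, nyz, nuz, -⟩
  have hdx : G.dist w x = 2 := SimpleGraph.dist_eq_two_of_common_neighbor hxw.symm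
    (fun h => nxw h.symm) hwz hzx
  have hdy : G.dist w y = 2 := SimpleGraph.dist_eq_two_of_common_neighbor hyw.symm
    (fun h => nyw h.symm) hvw.symm hyv.symm
  obtain ⟨s, hxs, hys, hws⟩ := hpm.2.1.1 w x y hxy (by omega) (by omega)
  have hws : G.Adj w s := SimpleGraph.dist_eq_one_iff_adj.mp (by omega)
  obtain ⟨hsu, hsz⟩ := hpm.adj_of_adj_opposite
    (⟨hux.symm, hwu.symm, hwz, hzx, hxw, huz, nxw, nuz⟩ : InducedSquare G x u w z)
    hxs.symm hws.symm (fun h => nyu (h ▸ hys)) (fun h => nyz (h ▸ hys))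
  exact hprop ⟨x, s, y, u, z, hxs, hxy, hux.symm, hzx.symm, hys.symm, hsu, hsz,
    hyu, huz, hyz, nyu, nuz, nyz⟩

/-- Two opposite vertices of an induced square cannot both be at distance `k` from `u` when
a third one is at distance `k + 1`, unless the fourth one is at distance `k - 1`. -/
theorem dist_add_one_eq_of_opposite (hpm : PreMedian G) {u a b c d : V}
    (h : InducedSquare G a b c d) (hac : G.dist u a = G.dist u c)
    (hd : G.dist u d = G.dist u a + 1) : G.dist u b + 1 = G.dist u a := by
  have hsq := h
  obtain ⟨hab, hbc, hcd, hda, hne, hbd, hnac, hnbd⟩ := h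
  obtain ⟨x, hax, hcx, hx⟩ := hpm.2.1.2 u a c d hda hcd.symm
    (SimpleGraph.dist_eq_two_of_common_neighbor hne hnac hab hbc) hac hd
  by_cases hxb : x = b
  · rwa [← hxb]
  obtain ⟨-, hxd⟩ := hpm.adj_of_adj_opposite hsq hax.symm hcx.symm hxb
    (by rintro rfl; omega)
  have := hpm.1.dist_le_dist_add_one_of_adj u hxd
  omega

/-- Three vertices of an induced square cannot all be at distance `k + 1` from `u` when the
fourth one is at distance `k`. -/
theorem not_dist_succ_of_square (hpm : PreMedian G) (hprop : ¬ HasInducedPropeller G)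
    {u a b c d : V} (hsq : InducedSquare G a b c d) (hb : G.dist u b = G.dist u a + 1)
    (hc : G.dist u c = G.dist u a + 1) : G.dist u d ≠ G.dist u a + 1 := by
  intro hd
  have hle {v w : V} (h : G.Adj v w) := hpm.1.dist_le_dist_add_one_of_adj u h
  obtain ⟨hab, hbc, hcd, hda, hne, hbd, hnac, hnbd⟩ := id hsq
  have hpos : 1 ≤ G.dist u a := by
    by_contra h0
    have hua : u = a := hpm.1.dist_eq_zero_iff.mp (by omega)
    subst hua
    exact hnac (SimpleGraph.dist_eq_one_iff_adj.mp (by omega))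
  obtain ⟨x, hbx, hcx, hx⟩ := hpm.2.1.1 u b c hbc (by omega) (by omega)
  have hxa : x ≠ a := by rintro rfl; exact hnac hcx.symm
  have hxd : x ≠ d := by rintro rfl; omega
  by_cases hadj : G.Adj x d
  · obtain ⟨-, hax⟩ := hpm.adj_of_adj_opposite hsq.rotate hbx.symm hadj hcx.ne' hxa
    obtain ⟨z, haz, hxz, hz⟩ := hpm.2.1.1 u a x hax.symm (by omega) hpos
    refine hprop ⟨a, x, b, d, z, hax.symm, hab, hda.symm, haz, hbx.symm, hadj, hxz, hbd,
      ?_, ?_, hnbd, ?_, ?_⟩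
    · rintro rfl; omega
    · rintro rfl; omega
    · intro h; have := hle h.symm; omega
    · intro h; have := hle h.symm; omega
  · have nax : ¬ G.Adj a x := fun h => hnbd (hpm.adj_of_adj_opposite
      (⟨h, hcx.symm, hcd, hda, hne, hxd, hnac, hadj⟩ : InducedSquare G a x c d)
      hab.symm hbc hbx.ne hbd).2
    obtain ⟨z, haz, hxz, hz⟩ := hpm.2.1.2 u a x b hab.symm hbx
      (SimpleGraph.dist_eq_two_of_common_neighbor hxa.symm nax hab hbx) (by omega) hb
    have far {v : V} (hv : G.dist u v = G.dist u a + 1) : z ≠ v ∧ ¬ G.Adj z v := by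
      refine ⟨by rintro rfl; omega, fun h => ?_⟩
      have := hle h
      omega
    exact hpm.not_hasInducedDoubleHouse hprop ⟨a, z, b, x, c, d, hbx, hcx.symm, hbc.symm, haz,
      hxz.symm, hab.symm, hcd, hda, hxa.symm, hne, (far hb).1, (far hc).1, (far hd).1, hbd, hxd,
      nax, hnac, (far hb).2, (far hc).2, (far hd).2, hnbd, hadj⟩

end PreMedian

theorem statement12 (G : SimpleGraph V) (hpm : PreMedian G)
    (hprop : ¬ HasInducedPropeller G) :
    (∀ u v₁ v₂ v₃ v₄ : V, InducedSquare G v₁ v₂ v₃ v₄ →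
      G.dist u v₁ + G.dist u v₃ = G.dist u v₂ + G.dist u v₄) ∧
    ¬ HasInducedDoubleHouse G := by
  refine ⟨fun u a b c d h => ?_, hpm.not_hasInducedDoubleHouse hprop⟩
  have h2 := h.rotate
  have h3 := h2.rotate
  have h4 := h3.rotate
  have hle {v w : V} (h : G.Adj v w) := hpm.1.dist_le_dist_add_one_of_adj u h
  have ab := hle h.1
  have ba := hle h.1.symm
  have bc := hle h2.1
  have cb := hle h2.1.symm
  have cd := hle h3.1
  have dc := hle h3.1.symm
  have da := hle h4.1
  have ad := hle h4.1.symm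
  have p1 := hpm.dist_add_one_eq_of_opposite (u := u) h
  have p2 := hpm.dist_add_one_eq_of_opposite (u := u) h2
  have p3 := hpm.dist_add_one_eq_of_opposite (u := u) h3
  have p4 := hpm.dist_add_one_eq_of_opposite (u := u) h4
  have q1 := hpm.not_dist_succ_of_square hprop (u := u) h
  have q2 := hpm.not_dist_succ_of_square hprop (u := u) h2
  have q3 := hpm.not_dist_succ_of_square hprop (u := u) h3
  have q4 := hpm.not_dist_succ_of_square hprop (u := u) h4
  omega
end

section
/- For a connected weakly modular graph G the following are equivalent: (i) there exists δ ≥ 0 such that G is δ-hyperbolic; (ii) there exist μ and κ such that every metric triangle of G has all pairwise distances at most μ and G contains no isometric square grid of side κ. -/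
variable {V : Type*}

/-- `G` is `δ`-hyperbolic: for any four vertices, the two larger of the three
pairwise distance sums differ by at most `2δ`. -/
def Hyperbolic (G : SimpleGraph V) (δ : ℝ) : Prop :=
  ∀ u v x y : V,
    (G.dist u v : ℝ) + (G.dist x y : ℝ) ≤
      max ((G.dist u x : ℝ) + (G.dist v y : ℝ))
        ((G.dist u y : ℝ) + (G.dist v x : ℝ)) + 2 * δ

/-- `v₁ v₂ v₃` is a metric triangle of `G`. -/
def MetricTriangle (G : SimpleGraph V) (v₁ v₂ v₃ : V) : Prop :=
  gInterval G v₁ v₂ ∩ gInterval G v₁ v₃ = {v₁} ∧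
  gInterval G v₂ v₁ ∩ gInterval G v₂ v₃ = {v₂} ∧
  gInterval G v₃ v₁ ∩ gInterval G v₃ v₂ = {v₃}

/-- `G` contains an isometric square grid of side `k`. -/
def IsoSquareGrid (G : SimpleGraph V) (k : ℕ) : Prop :=
  ∃ f : ℕ → ℕ → V, ∀ a a' b b' : ℕ, a ≤ k → a' ≤ k → b ≤ k → b' ≤ k →
    G.dist (f a b) (f a' b') = (max a a' - min a a') + (max b b' - min b b')

/-- Consecutive adjacency makes a sequence of vertices `1`-Lipschitz. -/
lemma dist_add_le_of_adj_succ {G : SimpleGraph V} (hconn : G.Connected) {g : ℕ → V} {n : ℕ}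
    (hg : ∀ i < n, G.Adj (g i) (g (i + 1))) {i j : ℕ} (hij : i ≤ j) (hj : j ≤ n) :
    G.dist (g i) (g j) + i ≤ j := by
  induction j, hij using Nat.le_induction with
  | base => simp
  | succ j hij ih =>
    have h1 := ih (by omega)
    have h2 := SimpleGraph.dist_eq_one_iff_adj.2 (hg j (by omega))
    have h3 := hconn.dist_triangle (u := g i) (v := g j) (w := g (j + 1))
    omega

/-- Any two vertices of a connected graph are joined by a geodesic. -/
lemma exists_geodesic {G : SimpleGraph V} (hconn : G.Connected) (u v : V) :
    ∃ g : ℕ → V, g 0 = u ∧ g (G.dist u v) = v ∧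
      ∀ i < G.dist u v, G.Adj (g i) (g (i + 1)) := by
  obtain ⟨p, hp⟩ := hconn.exists_walk_length_eq_dist u v
  refine ⟨p.getVert, p.getVert_zero, ?_, fun i hi => ?_⟩
  · rw [← hp, p.getVert_length]
  · exact p.adj_getVert_succ (by omega)

/-- Intervals contain vertices at every intermediate distance. -/
lemma exists_dist_eq_of_le {G : SimpleGraph V} (hconn : G.Connected) {u v : V} {k : ℕ}
    (hk : k ≤ G.dist u v) :
    ∃ x, G.dist u x = k ∧ G.dist u x + G.dist x v = G.dist u v := by
  obtain ⟨g, h0, hn, hg⟩ := exists_geodesic hconn u v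
  have h1 := dist_add_le_of_adj_succ hconn hg (Nat.zero_le k) hk
  have h2 := dist_add_le_of_adj_succ hconn hg hk le_rfl
  have h3 := hconn.dist_triangle (u := u) (v := g k) (w := v)
  rw [h0] at h1
  rw [hn] at h2
  exact ⟨g k, by omega, by omega⟩

/-- In a weakly modular graph, if `v` is closer to `u` than `w` is, then some neighbor of `w`
lies on geodesics from `w` to both `u` and `v`. -/
lemma WeaklyModular.exists_adj_closer {G : SimpleGraph V} (hconn : G.Connected)
    (hwm : WeaklyModular G) (u v w : V) (h : G.dist u v < G.dist u w) :
    ∃ r, G.Adj w r ∧ G.dist u r + 1 = G.dist u w ∧ G.dist v r + 1 = G.dist v w := by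
  obtain ⟨n, hn⟩ : ∃ n, G.dist v w = n := ⟨_, rfl⟩
  induction n generalizing w with
  | zero =>
    rw [hconn.dist_eq_zero_iff] at hn
    subst hn
    omega
  | succ n ih =>
    have tri := fun a b c => hconn.dist_triangle (u := a) (v := b) (w := c)
    have hadj : ∀ {a b : V}, G.Adj a b → G.dist a b = 1 :=
      fun h => SimpleGraph.dist_eq_one_iff_adj.2 h
    have hcomm : ∀ a b : V, G.dist a b = G.dist b a := fun a b => G.dist_comm
    obtain ⟨p, hp1, hp2⟩ := exists_dist_eq_of_le hconn (u := v) (v := w) (k := n) (by omega)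
    have hpw : G.Adj p w := SimpleGraph.dist_eq_one_iff_adj.1 (by omega)
    have hpw1 := hadj hpw
    by_cases hup : G.dist u p + 1 = G.dist u w
    · exact ⟨p, hpw.symm, hup, by omega⟩
    have := tri u p w
    have := tri u w p
    have := hcomm w p
    obtain ⟨q, hpq, huq, hvq⟩ := ih p (by omega) hp1
    have hpq1 := hadj hpq
    have hqw : G.dist q w = 2 := by
      have := tri v q w
      have := tri q p w
      have := hcomm q p
      omega
    rcases (show G.dist u p = G.dist u w + 1 ∨ G.dist u w = G.dist u p by omega) with hup' | hup'
    · obtain ⟨x, hqx, hwx, hux⟩ := hwm.2 u q w p hpq hpw hqw (by omega) (by omega)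
      refine ⟨x, hwx, by omega, ?_⟩
      have := tri v q x
      have := tri v x w
      have := hadj hqx
      have := hadj hwx.symm
      omega
    · obtain ⟨x, hwx, hpx, hux⟩ := hwm.1 u w p hpw.symm hup' (by omega)
      have hwx1 := hadj hwx
      have hpx1 := hadj hpx
      have hxq := tri x p q
      have := hcomm x p
      have := tri q x w
      have := hcomm q x
      have := hcomm x w
      by_cases hxq1 : G.dist x q = 1
      · refine ⟨x, hwx, hux, ?_⟩
        have := tri v q x
        have := tri v x w
        omega
      obtain ⟨y, hxy, hqy, huy⟩ := hwm.2 u x q p hpx hpq (by omega) (by omega) (by omega)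
      have := hadj hxy
      have := hadj hqy
      have := tri w x y
      have := tri u y w
      have := hcomm y w
      obtain ⟨r, hyr, hqr, hwr⟩ := hwm.1 w y q hqy.symm
        (by have := hcomm w q; omega) (by omega)
      have := hadj hyr
      have := hadj hqr
      have hwy : G.dist w y = 2 := by omega
      have hwr1 : G.dist w r = 1 := by omega
      refine ⟨r, SimpleGraph.dist_eq_one_iff_adj.1 hwr1, ?_, ?_⟩
      · have := tri u y r
        have := tri u r w
        have := hcomm r w
        omega
      · have := tri v q r
        have := tri v r w
        have := hcomm r w
        omega

/-- Iterated form of `WeaklyModular.exists_adj_closer`: one may descend from `w` simultaneously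
towards `u` and `v` until the level of `v` is reached. -/
lemma WeaklyModular.exists_dist_eq {G : SimpleGraph V} (hconn : G.Connected)
    (hwm : WeaklyModular G) (u v w : V) (h : G.dist u v ≤ G.dist u w) :
    ∃ x, G.dist u x = G.dist u v ∧ G.dist w x + G.dist x u = G.dist w u ∧
      G.dist w x + G.dist x v = G.dist w v := by
  obtain ⟨n, hn⟩ : ∃ n, G.dist u w = G.dist u v + n := ⟨_, (Nat.add_sub_cancel' h).symm⟩
  induction n generalizing w with
  | zero => exact ⟨w, by omega, by simp, by simp⟩
  | succ n ih =>
    obtain ⟨r, hwr, hur, hvr⟩ := hwm.exists_adj_closer hconn u v w (by omega)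
    obtain ⟨x, hx, hxu, hxv⟩ := ih r (by omega) (by omega)
    have := hconn.dist_triangle (u := w) (v := r) (w := x)
    have := hconn.dist_triangle (u := w) (v := x) (w := u)
    have := hconn.dist_triangle (u := w) (v := x) (w := v)
    have := SimpleGraph.dist_eq_one_iff_adj.2 hwr
    have := G.dist_comm (u := w) (v := u)
    have := G.dist_comm (u := w) (v := v)
    have := G.dist_comm (u := r) (v := u)
    have := G.dist_comm (u := r) (v := v)
    exact ⟨x, hx, by omega, by omega⟩

lemma MetricTriangle.rotate {G : SimpleGraph V} {u v w : V} (h : MetricTriangle G u v w) :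
    MetricTriangle G v w u := by
  obtain ⟨h1, h2, h3⟩ := h
  exact ⟨by rwa [Set.inter_comm], by rwa [Set.inter_comm], h1⟩

/-- In a metric triangle `u v w` of a weakly modular graph, no vertex of the side `I(v,w)` is closer
to `u` than `w` is. -/
lemma MetricTriangle.dist_le {G : SimpleGraph V} (hconn : G.Connected) (hwm : WeaklyModular G)
    {u v w x : V} (h : MetricTriangle G u v w)
    (hx : G.dist v x + G.dist x w = G.dist v w) : G.dist u w ≤ G.dist u x := by
  by_contra! hlt
  obtain ⟨r, hwr, hur, hxr⟩ := hwm.exists_adj_closer hconn u x w hlt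
  have hr : r ∈ gInterval G w u ∩ gInterval G w v := by
    have := SimpleGraph.dist_eq_one_iff_adj.2 hwr
    have := hconn.dist_triangle (u := v) (v := x) (w := r)
    have := hconn.dist_triangle (u := v) (v := r) (w := w)
    have := G.dist_comm (u := w) (v := r)
    have := G.dist_comm (u := r) (v := u)
    have := G.dist_comm (u := r) (v := v)
    have := G.dist_comm (u := w) (v := u)
    have := G.dist_comm (u := w) (v := v)
    constructor <;> simp only [gInterval, Set.mem_ofPred_eq] <;> omega
  rw [h.2.2, Set.mem_singleton_iff] at hr
  exact hwr.ne hr.symm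

/-- Metric triangles of a hyperbolic weakly modular graph are bounded. -/
lemma MetricTriangle.dist_le_of_hyperbolic {G : SimpleGraph V} (hconn : G.Connected)
    (hwm : WeaklyModular G) {δ : ℝ} (hδ : Hyperbolic G δ) {u v w : V}
    (h : MetricTriangle G u v w) : G.dist u v ≤ ⌈4 * δ⌉₊ + 1 := by
  have h1 := h.dist_le hconn hwm (x := v) (by simp)
  have h2 := h.rotate.dist_le hconn hwm (x := w) (by simp)
  have h3 := h.rotate.rotate.dist_le hconn hwm (x := u) (by simp)
  have c1 := G.dist_comm (u := v) (v := u)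
  have c2 := G.dist_comm (u := w) (v := u)
  have c3 := G.dist_comm (u := w) (v := v)
  obtain ⟨x, hx1, hx2⟩ := exists_dist_eq_of_le hconn (u := v) (v := w)
    (k := G.dist v w / 2) (by omega)
  have h4 := h.dist_le hconn hwm hx2
  have h5 := hδ u x v w
  have c4 := G.dist_comm (u := x) (v := v)
  have h6 : max ((G.dist u v : ℝ) + G.dist x w) (G.dist u w + G.dist x v) * 2 ≤
      3 * G.dist u v + 1 := by
    rw [max_mul_of_nonneg _ _ (by norm_num)]
    refine max_le ?_ ?_ <;> norm_cast <;> omega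
  have h7 : 2 * (G.dist u v : ℝ) ≤ G.dist u x + G.dist v w := by norm_cast; omega
  have h8 := Nat.le_ceil (4 * δ)
  have : (G.dist u v : ℝ) ≤ ⌈4 * δ⌉₊ + 1 := by linarith
  exact_mod_cast this

/-- Isometric square grids of a hyperbolic graph are bounded. -/
lemma IsoSquareGrid.le_of_hyperbolic {G : SimpleGraph V} {δ : ℝ} (hδ : Hyperbolic G δ) {k : ℕ}
    (h : IsoSquareGrid G k) : (k : ℝ) ≤ δ := by
  obtain ⟨f, hf⟩ := h
  have := hδ (f 0 0) (f k k) (f 0 k) (f k 0)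
  simp [hf] at this
  linarith

/-- If metric triangles have sides at most `μ`, then the geodesics from `u` to `v` and `w` may be
chosen to share an initial segment of length almost the Gromov product. -/
lemma exists_common_prefix {G : SimpleGraph V} (hconn : G.Connected) {μ : ℕ}
    (hμ : ∀ v₁ v₂ v₃ : V, MetricTriangle G v₁ v₂ v₃ →
      G.dist v₁ v₂ ≤ μ ∧ G.dist v₂ v₃ ≤ μ ∧ G.dist v₁ v₃ ≤ μ) (u v w : V) :
    ∃ x, G.dist u x + G.dist x v = G.dist u v ∧ G.dist u x + G.dist x w = G.dist u w ∧
      G.dist u v + G.dist u w ≤ G.dist v w + 2 * G.dist u x + 2 * μ := by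
  obtain ⟨n, hn⟩ : ∃ n, G.dist u v + G.dist v w + G.dist u w = n := ⟨_, rfl⟩
  induction n using Nat.strong_induction_on generalizing u v w with
  | _ n ih =>
    have tri := fun a b c => hconn.dist_triangle (u := a) (v := b) (w := c)
    have hcomm : ∀ a b : V, G.dist a b = G.dist b a := fun a b => G.dist_comm
    have key : ∀ a b c : V, ¬ gInterval G a b ∩ gInterval G a c = {a} →
        ∃ t, 0 < G.dist a t ∧ G.dist a t + G.dist t b = G.dist a b ∧
          G.dist a t + G.dist t c = G.dist a c := by
      intro a b c hne
      by_contra! hall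
      refine hne (Set.eq_singleton_iff_unique_mem.2 ⟨⟨by simp [gInterval], by simp [gInterval]⟩, ?_⟩)
      rintro t ⟨ht1, ht2⟩
      by_contra hta
      exact hall t (hconn.pos_dist_of_ne (Ne.symm hta)) ht1 ht2
    by_cases hu : gInterval G u v ∩ gInterval G u w = {u}
    swap
    · obtain ⟨t, ht0, ht1, ht2⟩ := key u v w hu
      obtain ⟨x, hx1, hx2, hx3⟩ := ih _ (by omega) t v w rfl
      have := tri u t x
      have := tri u x v
      have := tri u x w
      exact ⟨x, by omega, by omega, by omega⟩
    by_cases hv : gInterval G v u ∩ gInterval G v w = {v}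
    swap
    · obtain ⟨t, ht0, ht1, ht2⟩ := key v u w hv
      have := hcomm t u
      have := hcomm v u
      have := hcomm v t
      obtain ⟨x, hx1, hx2, hx3⟩ := ih _ (by omega) u t w rfl
      have := tri x t v
      have := tri u x v
      exact ⟨x, by omega, by omega, by omega⟩
    by_cases hw : gInterval G w u ∩ gInterval G w v = {w}
    swap
    · obtain ⟨t, ht0, ht1, ht2⟩ := key w u v hw
      have := hcomm t u
      have := hcomm w u
      have := hcomm w v
      have := hcomm t v
      have := hcomm w t
      obtain ⟨x, hx1, hx2, hx3⟩ := ih _ (by omega) u v t rfl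
      have := tri x t w
      have := tri u x w
      exact ⟨x, by omega, by omega, by omega⟩
    have := hμ u v w ⟨hu, hv, hw⟩
    exact ⟨u, by simp, by simp, by omega⟩

open Classical in
/-- A common neighbor of `a` and `b` that is closer to `v` than `a`, if there is one. -/
noncomputable def gridStep (G : SimpleGraph V) (v a b : V) : V :=
  if h : ∃ x, G.Adj a x ∧ G.Adj b x ∧ G.dist v x + 1 = G.dist v a then h.choose else a

lemma gridStep_spec {G : SimpleGraph V} {v a b : V}
    (h : ∃ x, G.Adj a x ∧ G.Adj b x ∧ G.dist v x + 1 = G.dist v a) :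
    G.Adj a (gridStep G v a b) ∧ G.Adj b (gridStep G v a b) ∧
      G.dist v (gridStep G v a b) + 1 = G.dist v a := by
  rw [gridStep, dif_pos h]
  exact h.choose_spec

/-- The grid spanned by two geodesics `g` and `h`, filled in towards `v`. -/
noncomputable def gridFill (G : SimpleGraph V) (v : V) (g h : ℕ → V) : ℕ → ℕ → V
  | 0, j => h j
  | i + 1, 0 => g (i + 1)
  | i + 1, j + 1 => gridStep G v (gridFill G v g h (i + 1) j) (gridFill G v g h i (j + 1))

/-- In a weakly modular graph, two geodesics of length `n` from `p` towards `v` whose ends are at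
distance `2 * n` span an isometric square grid. -/
lemma WeaklyModular.isoSquareGrid {G : SimpleGraph V} (hconn : G.Connected)
    (hwm : WeaklyModular G) {p v x y : V} {n : ℕ} (hpx : G.dist p x = n) (hpy : G.dist p y = n)
    (hxy : G.dist x y = 2 * n) (hx : n + G.dist x v = G.dist p v)
    (hy : n + G.dist y v = G.dist p v) : IsoSquareGrid G n := by
  have tri := fun a b c => hconn.dist_triangle (u := a) (v := b) (w := c)
  have hcomm : ∀ a b : V, G.dist a b = G.dist b a := fun a b => G.dist_comm
  have hadj : ∀ {a b : V}, G.Adj a b → G.dist a b = 1 :=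
    fun h => SimpleGraph.dist_eq_one_iff_adj.2 h
  obtain ⟨g, hg0, hgn, hg⟩ := exists_geodesic hconn p x
  obtain ⟨h, hh0, hhn, hh⟩ := exists_geodesic hconn p y
  rw [hpx] at hgn hg
  rw [hpy] at hhn hh
  set f := gridFill G v g h with hf
  let Inv : ℕ → ℕ → Prop := fun i j => G.dist v (f i j) + i + j = G.dist p v ∧
    G.dist x (f i j) + i ≤ n + j ∧ G.dist y (f i j) + j ≤ n + i
  have hf0 : ∀ j, f 0 j = h j := fun j => by rw [hf, gridFill]
  have hfi : ∀ i, f i 0 = g i := by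
    intro i
    cases i with
    | zero => rw [hf0, hh0, hg0]
    | succ i => rw [hf, gridFill]
  have hfs : ∀ i j, f (i + 1) (j + 1) = gridStep G v (f (i + 1) j) (f i (j + 1)) := by
    intro i j
    rw [hf, gridFill]
  have hleft : ∀ i ≤ n, Inv i 0 := by
    intro i hi
    have h1 := dist_add_le_of_adj_succ hconn hg (Nat.zero_le i) hi
    have h2 := dist_add_le_of_adj_succ hconn hg hi le_rfl
    rw [hg0] at h1
    rw [hgn] at h2
    have := tri p (g i) v
    have := tri (g i) x v
    have := tri y p (g i)
    have := hcomm x (g i)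
    have := hcomm v (g i)
    have := hcomm y p
    simp only [Inv, hfi]
    omega
  have hbot : ∀ j ≤ n, Inv 0 j := by
    intro j hj
    have h1 := dist_add_le_of_adj_succ hconn hh (Nat.zero_le j) hj
    have h2 := dist_add_le_of_adj_succ hconn hh hj le_rfl
    rw [hh0] at h1
    rw [hhn] at h2
    have := tri p (h j) v
    have := tri (h j) y v
    have := tri x p (h j)
    have := hcomm y (h j)
    have := hcomm v (h j)
    have := hcomm x p
    simp only [Inv, hf0]
    omega
  have hstep : ∀ i j, Inv (i + 1) j → Inv i (j + 1) → Inv i j →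
      G.Adj (f i j) (f (i + 1) j) → G.Adj (f i j) (f i (j + 1)) →
      Inv (i + 1) (j + 1) ∧ G.Adj (f i (j + 1)) (f (i + 1) (j + 1)) ∧
        G.Adj (f (i + 1) j) (f (i + 1) (j + 1)) := by
    intro i j h1 h2 h3 a1 a2
    simp only [Inv] at h1 h2 h3
    have hex := hwm.2 v (f (i + 1) j) (f i (j + 1)) (f i j) a1 a2 (by
      have := tri (f (i + 1) j) (f i j) (f i (j + 1))
      have := hadj a1.symm
      have := hadj a2
      have := tri x (f (i + 1) j) y
      have := tri (f (i + 1) j) (f i (j + 1)) y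
      have := hcomm (f i (j + 1)) y
      omega) (by omega) (by omega)
    have hspec := gridStep_spec hex
    rw [← hfs] at hspec
    obtain ⟨b1, b2, b3⟩ := hspec
    refine ⟨?_, b2, b1⟩
    have := tri x (f (i + 1) j) (f (i + 1) (j + 1))
    have := tri y (f i (j + 1)) (f (i + 1) (j + 1))
    have := hadj b1
    have := hadj b2
    simp only [Inv]
    omega
  have hrow : ∀ i ≤ n, (∀ j ≤ n, Inv i j) ∧ (∀ j < n, G.Adj (f i j) (f i (j + 1))) ∧
      (i < n → ∀ j ≤ n, G.Adj (f i j) (f (i + 1) j)) := by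
    have hnext : ∀ i < n, (∀ j ≤ n, Inv i j) → (∀ j < n, G.Adj (f i j) (f i (j + 1))) →
        ∀ j ≤ n, Inv (i + 1) j ∧ G.Adj (f i j) (f (i + 1) j) ∧
          (j < n → G.Adj (f (i + 1) j) (f (i + 1) (j + 1))) := by
      intro i hi hI hA j
      have hcol : ∀ j ≤ n, Inv (i + 1) j ∧ G.Adj (f i j) (f (i + 1) j) := by
        intro j
        induction j with
        | zero =>
          intro _
          refine ⟨hleft _ hi, ?_⟩
          rw [hfi, hfi]
          exact hg i hi
        | succ j ih =>
          intro hj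
          obtain ⟨i1, i2⟩ := ih (by omega)
          have := hstep i j i1 (hI _ hj) (hI _ (by omega)) i2 (hA _ hj)
          exact ⟨this.1, this.2.1⟩
      intro hj
      refine ⟨(hcol j hj).1, (hcol j hj).2, fun hjn => ?_⟩
      exact (hstep i j (hcol j hj).1 (hI _ hjn) (hI _ hj) (hcol j hj).2 (hA _ hjn)).2.2
    intro i
    induction i with
    | zero =>
      intro _
      have hA : ∀ j < n, G.Adj (f 0 j) (f 0 (j + 1)) := fun j hj => by
        rw [hf0, hf0]
        exact hh j hj
      exact ⟨hbot, hA, fun hi j hj => (hnext 0 hi hbot hA j hj).2.1⟩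
    | succ i ih =>
      intro hi
      obtain ⟨hI, hA, -⟩ := ih (by omega)
      have hI' : ∀ j ≤ n, Inv (i + 1) j := fun j hj => (hnext i hi hI hA j hj).1
      have hA' : ∀ j < n, G.Adj (f (i + 1) j) (f (i + 1) (j + 1)) :=
        fun j hj => (hnext i hi hI hA j hj.le).2.2 hj
      exact ⟨hI', hA', fun hi' j hj => (hnext (i + 1) hi' hI' hA' j hj).2.1⟩
  have hdist : ∀ a a' b b' : ℕ, a ≤ a' → a' ≤ n → b ≤ n → b' ≤ n →
      G.dist (f a b) (f a' b') = (a' - a) + (max b b' - min b b') := by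
    intro a a' b b' haa ha' hb hb'
    have h1 := dist_add_le_of_adj_succ hconn (g := fun i => f i b) (n := n)
      (fun i hi => (hrow i hi.le).2.2 hi b hb) haa ha'
    have t1 := tri (f a b) (f a' b) (f a' b')
    obtain ⟨p1, p2, p3⟩ := (hrow a (by omega)).1 b hb
    obtain ⟨q1, q2, q3⟩ := (hrow a' ha').1 b' hb'
    rcases le_total b b' with hbb | hbb
    · have h2 := dist_add_le_of_adj_succ hconn (hrow a' ha').2.1 hbb hb'
      have := tri v (f a' b') (f a b)
      have := hcomm (f a' b') (f a b)
      simp only [max_eq_right hbb, min_eq_left hbb]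
      omega
    · have h2 := dist_add_le_of_adj_succ hconn (hrow a' ha').2.1 hbb hb
      have := tri x (f a' b') y
      have := tri (f a' b') (f a b) y
      have := hcomm (f a b) y
      have := hcomm (f a' b') (f a b)
      have := hcomm (f a' b') (f a' b)
      simp only [max_eq_left hbb, min_eq_right hbb]
      omega
  refine ⟨f, fun a a' b b' ha ha' hb hb' => ?_⟩
  rcases le_total a a' with haa | haa
  · rw [hdist a a' b b' haa ha' hb hb', max_eq_right haa, min_eq_left haa]
  · rw [hcomm, hdist a' a b' b haa ha hb' hb, max_eq_left haa, min_eq_right haa,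
      max_comm, min_comm]

/-- Intervals of a weakly modular graph with bounded metric triangles and bounded isometric square
grids are uniformly thin. -/
lemma WeaklyModular.dist_le_of_mem_interval {G : SimpleGraph V} (hconn : G.Connected)
    (hwm : WeaklyModular G) {μ κ : ℕ}
    (hμ : ∀ v₁ v₂ v₃ : V, MetricTriangle G v₁ v₂ v₃ →
      G.dist v₁ v₂ ≤ μ ∧ G.dist v₂ v₃ ≤ μ ∧ G.dist v₁ v₃ ≤ μ) (hκ : ¬ IsoSquareGrid G κ)
    {u v x y : V} (hx : G.dist u x + G.dist x v = G.dist u v)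
    (hy : G.dist u y + G.dist y v = G.dist u v) (hxy : G.dist u x = G.dist u y) :
    G.dist x y ≤ 2 * κ + 2 * μ := by
  by_contra! hlt
  have tri := fun a b c => hconn.dist_triangle (u := a) (v := b) (w := c)
  have hcomm : ∀ a b : V, G.dist a b = G.dist b a := fun a b => G.dist_comm
  obtain ⟨z, hz1, hz2, hz3⟩ := exists_common_prefix hconn hμ x u y
  have := hcomm x u
  obtain ⟨p, hp1, hp2⟩ := exists_dist_eq_of_le hconn (u := x) (v := z) (k := κ) (by omega)
  have := tri x p u
  have := tri p z u
  have := tri x p y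
  have := tri p z y
  have := tri p x v
  have := hcomm p x
  have := tri u p v
  have := hcomm p u
  obtain ⟨q, hq1, hq2, hq3⟩ := hwm.exists_dist_eq hconn v y p (by
    have := hcomm v y
    have := hcomm v p
    omega)
  have := hcomm v y
  have := hcomm v q
  have := hcomm v p
  have := tri x p q
  have := tri x q y
  exact hκ (hwm.isoSquareGrid hconn (p := p) (v := v) (x := x) (y := q)
    (by omega) (by omega) (by omega) (by omega) (by omega))

theorem statement14 (G : SimpleGraph V) (hconn : G.Connected)
    (hwm : WeaklyModular G) :
    (∃ δ : ℝ, 0 ≤ δ ∧ Hyperbolic G δ) ↔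
      (∃ μ κ : ℕ,
        (∀ v₁ v₂ v₃ : V, MetricTriangle G v₁ v₂ v₃ →
          G.dist v₁ v₂ ≤ μ ∧ G.dist v₂ v₃ ≤ μ ∧ G.dist v₁ v₃ ≤ μ) ∧
        ¬ IsoSquareGrid G κ) := by
  constructor
  · rintro ⟨δ, -, hδ⟩
    refine ⟨⌈4 * δ⌉₊ + 1, ⌈δ⌉₊ + 1, fun v₁ v₂ v₃ h => ⟨?_, ?_, ?_⟩, fun h => ?_⟩
    · exact h.dist_le_of_hyperbolic hconn hwm hδ
    · exact h.rotate.dist_le_of_hyperbolic hconn hwm hδ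
    · rw [G.dist_comm]
      exact h.rotate.rotate.dist_le_of_hyperbolic hconn hwm hδ
    · have h1 := h.le_of_hyperbolic hδ
      have h2 := Nat.le_ceil δ
      push_cast at h1
      linarith
  · rintro ⟨μ, κ, hμ, hκ⟩
    refine ⟨((2 * μ + κ : ℕ) : ℝ), Nat.cast_nonneg _, fun u v x y => ?_⟩
    have tri := fun a b c => hconn.dist_triangle (u := a) (v := b) (w := c)
    obtain ⟨a₀, ha1, ha2, ha3⟩ := exists_common_prefix hconn hμ u x v
    obtain ⟨b₀, hb1, hb2, hb3⟩ := exists_common_prefix hconn hμ u y v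
    obtain ⟨a, ha4, ha5⟩ := exists_dist_eq_of_le hconn (u := u) (v := a₀)
      (k := min (G.dist u a₀) (G.dist u b₀)) (min_le_left _ _)
    obtain ⟨b, hb4, hb5⟩ := exists_dist_eq_of_le hconn (u := u) (v := b₀)
      (k := min (G.dist u a₀) (G.dist u b₀)) (min_le_right _ _)
    have := tri a a₀ x
    have := tri a a₀ v
    have := tri u a x
    have := tri u a v
    have := tri b b₀ y
    have := tri b b₀ v
    have := tri u b y
    have := tri u b v
    have hab := hwm.dist_le_of_mem_interval hconn hμ hκ (u := u) (v := v) (x := a) (y := b)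
      (by omega) (by omega) (by omega)
    have := tri x a y
    have := tri a b y
    have := G.dist_comm (u := x) (v := a)
    have := G.dist_comm (u := x) (v := v)
    have := G.dist_comm (u := y) (v := v)
    norm_cast
    omega
end

section
/- Let G be a connected weakly modular graph in which every metric triangle has all pairwise distances at most μ and every isometric square grid has side at most κ. Then all intervals of G are (2κ+μ)-thin: for all vertices u,v and all x,y ∈ I(u,v) with d(u,x) = d(u,y) and d(v,x) = d(v,y), one has d(x,y) ≤ 2κ+μ. Consequently, G is (32κ+20μ)-hyperbolic. -/
variable {V : Type*}

namespace SimpleGraph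

variable {G : SimpleGraph V}

theorem Connected.dist_le_dist_add_one (hconn : G.Connected) {v w : V} (h : G.Adj v w) (u : V) :
    G.dist u v ≤ G.dist u w + 1 ∧ G.dist u w ≤ G.dist u v + 1 := by
  have h₁ := hconn.dist_triangle (u := u) (v := v) (w := w)
  have h₂ := hconn.dist_triangle (u := u) (v := w) (w := v)
  rw [dist_eq_one_iff_adj.mpr h] at h₁
  rw [dist_eq_one_iff_adj.mpr h.symm] at h₂
  omega

theorem Connected.dist_eq_two (hconn : G.Connected) {u v z w : V} (hv : G.Adj z v) (hw : G.Adj z w)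
    (h : G.dist u w + 2 ≤ G.dist u v) : G.dist v w = 2 := by
  have h₁ := hconn.dist_triangle (u := v) (v := z) (w := w)
  have h₂ := hconn.dist_triangle (u := u) (v := w) (w := v)
  rw [dist_eq_one_iff_adj.mpr hv.symm, dist_eq_one_iff_adj.mpr hw] at h₁
  rw [dist_comm (u := w) (v := v)] at h₂
  omega

/-- A parametrized geodesic between two vertices. -/
theorem Connected.exists_geodesic (hconn : G.Connected) (x y : V) :
    ∃ p : ℕ → V, p 0 = x ∧ (∀ i ≤ G.dist x y, G.dist x (p i) = i ∧
      G.dist (p i) y + i = G.dist x y) ∧ ∀ i < G.dist x y, G.Adj (p i) (p (i + 1)) := by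
  obtain ⟨w, hw⟩ := hconn.exists_walk_length_eq_dist x y
  refine ⟨w.getVert, w.getVert_zero, fun i hi => ?_, fun i hi =>
    w.adj_getVert_succ (hw ▸ hi)⟩
  have h₁ := dist_le (w.take i)
  have h₂ := dist_le (w.drop i)
  have h₃ := hconn.dist_triangle (u := x) (v := w.getVert i) (w := y)
  rw [Walk.take_length] at h₁
  rw [Walk.drop_length] at h₂
  omega

/-- In a weakly modular graph, if `w` is closer to `u` than `v` is, then some neighbour of `v` is
simultaneously closer to `w` and to `u`. -/
theorem Connected.exists_adj_closer (hconn : G.Connected) (hwm : WeaklyModular G) (u w : V) (v : V)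
    (h : G.dist u w < G.dist u v) :
    ∃ z, G.Adj v z ∧ G.dist z w + 1 = G.dist v w ∧ G.dist u z + 1 = G.dist u v := by
  induction hn : G.dist v w generalizing v with
  | zero => rw [hconn.dist_eq_zero_iff.mp hn] at h; omega
  | succ n ih =>
    obtain ⟨p, hp0, hp, hadj⟩ := hconn.exists_geodesic v w
    have hvz : G.Adj v (p 1) := hp0 ▸ hadj 0 (by omega)
    obtain ⟨-, hz⟩ := hp 1 (by omega)
    generalize p 1 = z at hvz hz
    have hl := hconn.dist_le_dist_add_one hvz u
    by_cases hlt : G.dist u z < G.dist u v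
    · exact ⟨z, hvz, by omega, by omega⟩
    obtain ⟨t, hzt, htw, htu⟩ := ih z (by omega) (by omega)
    have hvt : G.dist v t = 2 := by
      have h₁ := hconn.dist_triangle (u := v) (v := t) (w := w)
      have h₂ := hconn.dist_triangle (u := v) (v := z) (w := t)
      rw [dist_eq_one_iff_adj.mpr hvz, dist_eq_one_iff_adj.mpr hzt] at h₂
      omega
    -- it suffices to find a common neighbour of `v` and `t` closer to `u`
    suffices ∃ s, G.Adj v s ∧ G.Adj s t ∧ G.dist u s + 1 = G.dist u v by
      obtain ⟨s, hvs, hst, hs⟩ := this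
      refine ⟨s, hvs, ?_, hs⟩
      have h₁ := hconn.dist_triangle (u := v) (v := s) (w := w)
      have h₂ := hconn.dist_triangle (u := s) (v := t) (w := w)
      rw [dist_eq_one_iff_adj.mpr hvs] at h₁
      rw [dist_eq_one_iff_adj.mpr hst] at h₂
      omega
    by_cases hup : G.dist u z = G.dist u v + 1
    · obtain ⟨s, h₁, h₂, h₃⟩ := hwm.2 u v t z hvz.symm hzt hvt (by omega) hup
      exact ⟨s, h₁, h₂.symm, h₃⟩
    · obtain ⟨q, hvq, hzq, hq⟩ := hwm.1 u v z hvz (by omega) (by omega)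
      by_cases hqt : G.Adj q t
      · exact ⟨q, hvq, hqt, hq⟩
      have hqt2 : G.dist q t = 2 := by
        have h₂ := hconn.dist_triangle (u := q) (v := z) (w := t)
        have h₃ : G.dist q t ≠ 1 := fun h => hqt (dist_eq_one_iff_adj.mp h)
        have h₄ : G.dist q t ≠ 0 := by
          intro h
          rw [← hconn.dist_eq_zero_iff.mp h, dist_eq_one_iff_adj.mpr hvq] at hvt
          omega
        rw [dist_eq_one_iff_adj.mpr hzq.symm, dist_eq_one_iff_adj.mpr hzt] at h₂
        omega
      obtain ⟨r, hqr, htr, hr⟩ := hwm.2 u q t z hzq hzt hqt2 (by omega) (by omega)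
      have hvr : G.dist v r = 2 := hconn.dist_eq_two (u := u) hvq.symm hqr (by omega)
      obtain ⟨s, hts, hrs, hs⟩ := hwm.1 v t r htr (by omega) (by omega)
      have hvs : G.Adj v s := dist_eq_one_iff_adj.mp (by omega)
      have h₁ := hconn.dist_le_dist_add_one hvs u
      have h₂ := hconn.dist_le_dist_add_one hrs u
      exact ⟨s, hvs, hts.symm, by omega⟩

theorem Connected.dist_le_of_gInterval_inter (hconn : G.Connected) (hwm : WeaklyModular G)
    {u v w : V} (h : gInterval G v u ∩ gInterval G v w = {v}) : G.dist u v ≤ G.dist u w := by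
  by_contra! hlt
  obtain ⟨z, hvz, hzw, hzu⟩ := hconn.exists_adj_closer hwm u w v hlt
  have hmem : z ∈ gInterval G v u ∩ gInterval G v w := by
    constructor <;>
    simp only [gInterval, Set.mem_ofPred_eq, dist_eq_one_iff_adj.mpr hvz]
    · rw [dist_comm (u := z), dist_comm (u := v)]; omega
    · omega
  rw [h] at hmem
  exact hvz.ne hmem.symm

/-- Metric triangles of weakly modular graphs are equilateral. -/
theorem Connected.dist_eq_of_metricTriangle (hconn : G.Connected) (hwm : WeaklyModular G)
    {u v w : V} (h : MetricTriangle G u v w) : G.dist u v = G.dist u w :=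
  le_antisymm (hconn.dist_le_of_gInterval_inter hwm h.2.1)
    (hconn.dist_le_of_gInterval_inter hwm h.2.2)

/-- `a b c` lie on shortest paths between the vertices `x y z`, on all three sides. -/
def IsInscribed (G : SimpleGraph V) (x y z a b c : V) : Prop :=
  G.dist x a + G.dist a b + G.dist b y = G.dist x y ∧
  G.dist y b + G.dist b c + G.dist c z = G.dist y z ∧
  G.dist x a + G.dist a c + G.dist c z = G.dist x z

theorem IsInscribed.rotate {x y z a b c : V} (h : IsInscribed G x y z a b c) :
    IsInscribed G y z x b c a := by
  obtain ⟨h₁, h₂, h₃⟩ := h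
  simp only [IsInscribed]
  grind [dist_comm]

theorem IsInscribed.replace (hconn : G.Connected) {x y z a b c t : V}
    (h : IsInscribed G x y z a b c) (hb : t ∈ gInterval G a b) (hc : t ∈ gInterval G a c) :
    IsInscribed G x y z t b c := by
  obtain ⟨h₁, h₂, h₃⟩ := h
  simp only [gInterval, Set.mem_ofPred_eq] at hb hc
  have t₁ := hconn.dist_triangle (u := x) (v := a) (w := t)
  have t₂ := hconn.dist_triangle (u := x) (v := t) (w := y)
  have t₃ := hconn.dist_triangle (u := t) (v := b) (w := y)
  refine ⟨?_, h₂, ?_⟩ <;> omega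

/-- Every triple of vertices of a connected graph has a quasi-median. -/
theorem Connected.exists_quasiMedian (hconn : G.Connected) (x y z : V) :
    ∃ a b c, IsInscribed G x y z a b c ∧ MetricTriangle G a b c := by
  suffices ∀ n a b c, IsInscribed G x y z a b c → G.dist a b + G.dist b c + G.dist c a = n →
      ∃ a b c, IsInscribed G x y z a b c ∧ MetricTriangle G a b c from
    this _ x y z (by simp [IsInscribed]) rfl
  intro n
  induction n using Nat.strong_induction_on with
  | _ n ih =>
    have key : ∀ {p q r : V}, ¬ gInterval G p q ∩ gInterval G p r = {p} →
        ∃ t, t ∈ gInterval G p q ∧ t ∈ gInterval G p r ∧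
          G.dist t q + G.dist q r + G.dist r t < G.dist p q + G.dist q r + G.dist r p := by
      intro p q r hpqr
      have hp : p ∈ gInterval G p q ∩ gInterval G p r := by simp [gInterval]
      obtain ⟨t, ht, htp⟩ : ∃ t ∈ gInterval G p q ∩ gInterval G p r, t ≠ p := by
        by_contra! hall
        exact hpqr (Set.eq_singleton_iff_unique_mem.mpr ⟨hp, hall⟩)
      refine ⟨t, ht.1, ht.2, ?_⟩
      obtain ⟨ht₁, ht₂⟩ := ht
      simp only [gInterval, Set.mem_ofPred_eq] at ht₁ ht₂
      have := hconn.pos_dist_of_ne htp.symm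
      rw [dist_comm (u := r) (v := t), dist_comm (u := r) (v := p)]
      omega
    intro a b c hI hn
    by_cases h₁ : gInterval G a b ∩ gInterval G a c = {a}
    · by_cases h₂ : gInterval G b c ∩ gInterval G b a = {b}
      · by_cases h₃ : gInterval G c a ∩ gInterval G c b = {c}
        · exact ⟨a, b, c, hI, h₁, Set.inter_comm _ _ ▸ h₂, h₃⟩
        · obtain ⟨t, ha, hb, hlt⟩ := key h₃
          exact ih _ (by omega) a b t (hI.rotate.rotate.replace hconn ha hb).rotate rfl
      · obtain ⟨t, hc, ha, hlt⟩ := key h₂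
        exact ih _ (by omega) a t c (hI.rotate.replace hconn hc ha).rotate.rotate rfl
    · obtain ⟨t, hb, hc, hlt⟩ := key h₁
      exact ih _ (by omega) t b c (hI.replace hconn hb hc) rfl

/-- Fill in a grid from its first column `p` and first row `q`, completing squares by `c`. -/
def gridFill (c : V → V → V → V) (p q : ℕ → V) : ℕ → ℕ → V
  | i, 0 => p i
  | 0, j + 1 => q (j + 1)
  | i + 1, j + 1 =>
    c (gridFill c p q i j) (gridFill c p q (i + 1) j) (gridFill c p q i (j + 1))

/-- A grid with adjacent neighbouring entries on which two distance functions measure `j - i` and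
`-(i + j)` up to constants is isometric. -/
theorem Connected.isoSquareGrid_of_dist (hconn : G.Connected) {u y : V} {l d k : ℕ}
    (f : ℕ → ℕ → V)
    (hu : ∀ i ≤ k, ∀ j ≤ k, G.dist u (f i j) + i = l + j)
    (hy : ∀ i ≤ k, ∀ j ≤ k, G.dist y (f i j) + i + j = d)
    (hrow : ∀ i < k, ∀ j ≤ k, G.Adj (f i j) (f (i + 1) j))
    (hcol : ∀ i ≤ k, ∀ j < k, G.Adj (f i j) (f i (j + 1))) : IsoSquareGrid G k := by
  have hrow' : ∀ i n j, i + n ≤ k → j ≤ k → G.dist (f i j) (f (i + n) j) ≤ n := by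
    intro i n j hi hj
    induction n with
    | zero => simp
    | succ n ih =>
      have := (hconn.dist_le_dist_add_one (hrow (i + n) (by omega) j hj) (f i j)).2
      have := ih (by omega)
      simp only [← add_assoc]
      omega
  have hcol' : ∀ i j n, i ≤ k → j + n ≤ k → G.dist (f i j) (f i (j + n)) ≤ n := by
    intro i j n hi hj
    induction n with
    | zero => simp
    | succ n ih =>
      have := (hconn.dist_le_dist_add_one (hcol i hi (j + n) (by omega)) (f i j)).2
      have := ih (by omega)
      simp only [← add_assoc]
      omega
  have main : ∀ a a' b b', a ≤ a' → a' ≤ k → b ≤ k → b' ≤ k →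
      G.dist (f a b) (f a' b') = (a' - a) + (max b b' - min b b') := by
    intro a a' b b' haa ha hb hb'
    have t := hconn.dist_triangle (u := f a b) (v := f a' b) (w := f a' b')
    have t₁ := hconn.dist_triangle (u := y) (v := f a' b') (w := f a b)
    have t₂ := hconn.dist_triangle (u := u) (v := f a' b') (w := f a b)
    rw [dist_comm (u := f a' b') (v := f a b)] at t₁ t₂
    have hr := hrow' a (a' - a) b (by omega) hb
    rw [show a + (a' - a) = a' by omega] at hr
    have hy₁ := hy a (by omega) b hb
    have hy₂ := hy a' ha b' hb'
    have hu₁ := hu a (by omega) b hb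
    have hu₂ := hu a' ha b' hb'
    have t₃ := hconn.dist_triangle (u := u) (v := f a b) (w := f a' b')
    rcases le_total b b' with h | h
    · have hc := hcol' a' b (b' - b) ha (by omega)
      rw [show b + (b' - b) = b' by omega] at hc
      omega
    · have hc := hcol' a' b' (b - b') ha (by omega)
      rw [show b' + (b - b') = b by omega, dist_comm] at hc
      omega
  refine ⟨f, fun a a' b b' ha ha' hb hb' => ?_⟩
  rcases le_total a a' with h | h
  · rw [main a a' b b' h ha' hb hb']
    omega
  · rw [dist_comm, main a' a b' b h ha hb' hb]
    omega

/-- Two geodesic rays from `x`, one towards `u` and one away from `u`, both approaching `y`, span an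
isometric square grid. -/
theorem Connected.isoSquareGrid_of_geodesics (hconn : G.Connected) (hqc : QuadrangleCondition G)
    {u y x : V} {k : ℕ} (p q : ℕ → V) (hp0 : p 0 = x) (hq0 : q 0 = x)
    (hp : ∀ i < k, G.Adj (p i) (p (i + 1))) (hq : ∀ i < k, G.Adj (q i) (q (i + 1)))
    (hpu : ∀ i ≤ k, G.dist u (p i) + i = G.dist u x)
    (hpy : ∀ i ≤ k, G.dist y (p i) + i = G.dist y x)
    (hqu : ∀ i ≤ k, G.dist u (q i) = G.dist u x + i)
    (hqy : ∀ i ≤ k, G.dist y (q i) + i = G.dist y x) : IsoSquareGrid G k := by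
  have hc : ∀ z v w, ∃ t, G.Adj z v → G.Adj z w → G.dist v w = 2 →
      G.dist y v = G.dist y w → G.dist y z = G.dist y v + 1 →
      G.Adj v t ∧ G.Adj w t ∧ G.dist y t + 1 = G.dist y v := by
    intro z v w
    by_cases h : G.Adj z v ∧ G.Adj z w ∧ G.dist v w = 2 ∧
      G.dist y v = G.dist y w ∧ G.dist y z = G.dist y v + 1
    · obtain ⟨h₁, h₂, h₃, h₄, h₅⟩ := h
      obtain ⟨t, ht⟩ := hqc y v w z h₁ h₂ h₃ h₄ h₅
      exact ⟨t, fun _ _ _ _ _ => ht⟩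
    · exact ⟨z, fun h₁ h₂ h₃ h₄ h₅ => (h ⟨h₁, h₂, h₃, h₄, h₅⟩).elim⟩
  choose c hc using hc
  have main : ∀ i ≤ k, ∀ j ≤ k,
      G.dist u (gridFill c p q i j) + i = G.dist u x + j ∧
      G.dist y (gridFill c p q i j) + i + j = G.dist y x ∧
      (∀ i', i = i' + 1 → G.Adj (gridFill c p q i' j) (gridFill c p q i j)) ∧
      (∀ j', j = j' + 1 → G.Adj (gridFill c p q i j') (gridFill c p q i j)) := by
    intro i hi
    induction i with
    | zero =>
      intro j hj
      have hq' : ∀ j, gridFill c p q 0 j = q j := by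
        rintro (_ | j) <;> simp [gridFill, hp0, hq0]
      simp only [hq']
      refine ⟨hqu j hj, hqy j hj, by simp, ?_⟩
      rintro j' rfl
      exact hq j' (by omega)
    | succ i ihi =>
      intro j hj
      induction j with
      | zero =>
        simp only [gridFill]
        refine ⟨hpu _ hi, hpy _ hi, ?_, by simp⟩
        rintro i' h
        obtain rfl : i' = i := by omega
        exact hp _ (by omega)
      | succ j ihj =>
        obtain ⟨hu₀, hy₀, -, -⟩ := ihi (by omega) j (by omega)
        obtain ⟨hu₁, hy₁, ha₁, -⟩ := ihj (by omega)
        obtain ⟨hu₂, hy₂, -, ha₂⟩ := ihi (by omega) (j + 1) hj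
        have ha₁ := ha₁ i rfl
        have ha₂ := ha₂ j rfl
        have h2 := hconn.dist_eq_two (u := u) ha₂ ha₁ (by omega)
        rw [dist_comm] at h2
        obtain ⟨h₁, h₂, h₃⟩ := hc _ _ _ ha₁ ha₂ h2 (by omega) (by omega)
        have hl₁ := hconn.dist_le_dist_add_one h₁ u
        have hl₂ := hconn.dist_le_dist_add_one h₂ u
        rw [gridFill]
        refine ⟨by omega, by omega, ?_, ?_⟩
        · rintro i' h
          obtain rfl : i' = i := by omega
          exact h₂
        · rintro j' h
          obtain rfl : j' = j := by omega
          exact h₁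
  exact hconn.isoSquareGrid_of_dist (gridFill c p q) (fun i hi j hj => (main i hi j hj).1)
    (fun i hi j hj => (main i hi j hj).2.1)
    (fun i hi j hj => (main (i + 1) hi j hj).2.2.1 i rfl)
    (fun i hi j hj => (main i hi (j + 1) hj).2.2.2 j rfl)

theorem Connected.dist_of_mem_geodesic (hconn : G.Connected) {u x a s : V}
    (ha : G.dist x a + G.dist a u = G.dist x u) (hs : G.dist x s + G.dist s a = G.dist x a) :
    G.dist u s + G.dist x s = G.dist u x := by
  have h₁ := hconn.dist_triangle (u := s) (v := a) (w := u)
  have h₂ := hconn.dist_triangle (u := x) (v := s) (w := u)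
  rw [dist_comm (u := u) (v := s), dist_comm (u := u) (v := x)]
  omega

/-- If `a` and `b` are two vertices on geodesics from `x` to `y`, with `a` between `x` and `u`, `b`
between `x` and `v`, and `x` between `u` and `v`, then `x` is a corner of an isometric grid. -/
theorem Connected.isoSquareGrid_of_mem_gInterval (hconn : G.Connected)
    (hqc : QuadrangleCondition G) {u v x y a b : V} (hx : x ∈ gInterval G u v)
    (hau : a ∈ gInterval G x u) (hay : a ∈ gInterval G x y)
    (hbv : b ∈ gInterval G x v) (hby : b ∈ gInterval G x y) :
    IsoSquareGrid G (min (G.dist x a) (G.dist x b)) := by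
  simp only [gInterval, Set.mem_ofPred_eq] at hx hau hay hbv hby
  obtain ⟨p, hp0, hp, hpadj⟩ := hconn.exists_geodesic x a
  obtain ⟨q, hq0, hq, hqadj⟩ := hconn.exists_geodesic x b
  have hp' : ∀ i ≤ min (G.dist x a) (G.dist x b), ∀ t, G.dist x a + G.dist a t = G.dist x t →
      G.dist t (p i) + i = G.dist t x := by
    intro i hi t ht
    have := hp i (by omega)
    have := hconn.dist_of_mem_geodesic (s := p i) ht (by omega)
    omega
  have hq' : ∀ i ≤ min (G.dist x a) (G.dist x b), ∀ t, G.dist x b + G.dist b t = G.dist x t →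
      G.dist t (q i) + i = G.dist t x := by
    intro i hi t ht
    have := hq i (by omega)
    have := hconn.dist_of_mem_geodesic (s := q i) ht (by omega)
    omega
  refine hconn.isoSquareGrid_of_geodesics hqc p q hp0 hq0 (fun i hi => hpadj i (by omega))
    (fun i hi => hqadj i (by omega)) (fun i hi => hp' i hi u hau) (fun i hi => hp' i hi y hay)
    (fun i hi => ?_) (fun i hi => hq' i hi y hby)
  have h₁ := hq' i hi v hbv
  have h₂ := hconn.dist_triangle (u := u) (v := x) (w := q i)
  have h₃ := hconn.dist_triangle (u := u) (v := q i) (w := v)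
  have h₄ := hq i (by omega)
  rw [dist_comm (u := q i) (v := v)] at h₃
  rw [dist_comm (u := x) (v := v)] at hx
  omega

/-- For `x` and `y` equidistant from `u`, the geodesics from `x` to `u` and to `y` share a piece of
length at least half of `d(x, y) - μ`. -/
theorem Connected.exists_mem_gInterval_of_dist_eq (hconn : G.Connected) (hwm : WeaklyModular G)
    {μ : ℕ} (hmt : ∀ v₁ v₂ v₃ : V, MetricTriangle G v₁ v₂ v₃ → G.dist v₁ v₂ ≤ μ)
    {u x y : V} (h : G.dist u x = G.dist u y) :
    ∃ a, a ∈ gInterval G x u ∧ a ∈ gInterval G x y ∧ G.dist x y ≤ 2 * G.dist x a + μ := by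
  obtain ⟨a, b, c, ⟨h₁, h₂, h₃⟩, ht⟩ := hconn.exists_quasiMedian x y u
  have hs : G.dist b c = G.dist a c := by
    have := hconn.dist_eq_of_metricTriangle hwm
      (show MetricTriangle G c a b from ⟨ht.2.2, ht.1.symm ▸ Set.inter_comm _ _,
        ht.2.1 ▸ Set.inter_comm _ _⟩)
    rw [dist_comm (u := b), dist_comm (u := a), this]
  have hμ := hmt a b c ht
  have t₁ := hconn.dist_triangle (u := a) (v := c) (w := u)
  have t₂ := hconn.dist_triangle (u := x) (v := a) (w := u)
  have t₃ := hconn.dist_triangle (u := a) (v := b) (w := y)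
  have t₄ := hconn.dist_triangle (u := x) (v := a) (w := y)
  rw [dist_comm (u := u) (v := x), dist_comm (u := u) (v := y)] at h
  rw [dist_comm (u := y) (v := b)] at h₂
  refine ⟨a, ?_, ?_, ?_⟩
  · simp only [gInterval, Set.mem_ofPred_eq]; omega
  · simp only [gInterval, Set.mem_ofPred_eq]; omega
  · omega

/-- Thin intervals and bounded metric triangles give the four-point inequality. -/
theorem Connected.four_point_of_thin (hconn : G.Connected) {μ ν : ℕ}
    (hmt : ∀ v₁ v₂ v₃ : V, MetricTriangle G v₁ v₂ v₃ →
      G.dist v₁ v₂ ≤ μ ∧ G.dist v₂ v₃ ≤ μ ∧ G.dist v₁ v₃ ≤ μ)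
    (hthin : ∀ u v x y : V, x ∈ gInterval G u v → y ∈ gInterval G u v →
      G.dist u x = G.dist u y → G.dist v x = G.dist v y → G.dist x y ≤ ν) (u v x y : V) :
    G.dist u v + G.dist x y ≤
      max (G.dist u x + G.dist v y) (G.dist u y + G.dist v x) + (ν + 2 * μ) := by
  have key : ∀ t, ∃ c, G.dist u c + G.dist c t = G.dist u t ∧
      G.dist u c + G.dist c v = G.dist u v ∧
      G.dist u t + G.dist u v ≤ G.dist t v + 2 * G.dist u c + 2 * μ := by
    intro t
    obtain ⟨a, b, c, ⟨h₁, h₂, h₃⟩, ht⟩ := hconn.exists_quasiMedian u t v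
    obtain ⟨m₁, m₂, m₃⟩ := hmt a b c ht
    have t₁ := hconn.dist_triangle (u := a) (v := b) (w := t)
    have t₂ := hconn.dist_triangle (u := u) (v := a) (w := t)
    have t₃ := hconn.dist_triangle (u := a) (v := c) (w := v)
    have t₄ := hconn.dist_triangle (u := u) (v := a) (w := v)
    rw [dist_comm (u := t) (v := b)] at h₂
    exact ⟨a, by omega, by omega, by omega⟩
  have cut : ∀ t c m, m ≤ G.dist u c → G.dist u c + G.dist c t = G.dist u t →
      G.dist u c + G.dist c v = G.dist u v →
      ∃ p, G.dist u p = m ∧ G.dist p t + m = G.dist u t ∧ G.dist p v + m = G.dist u v := by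
    intro t c m hm h₁ h₂
    obtain ⟨p, -, hp, -⟩ := hconn.exists_geodesic u c
    obtain ⟨hp₁, hp₂⟩ := hp m hm
    have q₁ := hconn.dist_of_mem_geodesic (s := p m) h₁ (by omega)
    have q₂ := hconn.dist_of_mem_geodesic (s := p m) h₂ (by omega)
    rw [dist_comm (u := t), dist_comm (u := t)] at q₁
    rw [dist_comm (u := v), dist_comm (u := v)] at q₂
    exact ⟨p m, hp₁, by omega, by omega⟩
  obtain ⟨c, hc₁, hc₂, hc₃⟩ := key x
  obtain ⟨c', hc₁', hc₂', hc₃'⟩ := key y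
  obtain ⟨p, hp₁, hp₂, hp₃⟩ := cut x c (min (G.dist u c) (G.dist u c')) (by omega) hc₁ hc₂
  obtain ⟨p', hp₁', hp₂', hp₃'⟩ := cut y c' (min (G.dist u c) (G.dist u c')) (by omega) hc₁' hc₂'
  have hpp : G.dist p p' ≤ ν := by
    refine hthin u v p p' ?_ ?_ (by omega) ?_
    · simp only [gInterval, Set.mem_ofPred_eq]; omega
    · simp only [gInterval, Set.mem_ofPred_eq]; omega
    · rw [dist_comm (u := v), dist_comm (u := v)]; omega
  have t₁ := hconn.dist_triangle (u := x) (v := p) (w := y)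
  have t₂ := hconn.dist_triangle (u := p) (v := p') (w := y)
  rw [dist_comm (u := x) (v := p)] at t₁
  rw [dist_comm (u := v) (v := x), dist_comm (u := v) (v := y)]
  omega

end SimpleGraph

theorem statement16 (G : SimpleGraph V) (hconn : G.Connected)
    (hwm : WeaklyModular G) (μ κ : ℕ)
    (hmt : ∀ v₁ v₂ v₃ : V, MetricTriangle G v₁ v₂ v₃ →
      G.dist v₁ v₂ ≤ μ ∧ G.dist v₂ v₃ ≤ μ ∧ G.dist v₁ v₃ ≤ μ)
    (hgrid : ∀ k : ℕ, IsoSquareGrid G k → k ≤ κ) :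
    (∀ u v x y : V, x ∈ gInterval G u v → y ∈ gInterval G u v →
      G.dist u x = G.dist u y → G.dist v x = G.dist v y →
      G.dist x y ≤ 2 * κ + μ) ∧
    Hyperbolic G ((32 * κ + 20 * μ : ℕ) : ℝ) := by
  have thin : ∀ u v x y : V, x ∈ gInterval G u v → y ∈ gInterval G u v →
      G.dist u x = G.dist u y → G.dist v x = G.dist v y → G.dist x y ≤ 2 * κ + μ := by
    intro u v x y hx _ hu hv
    have hmt' := fun v₁ v₂ v₃ h => (hmt v₁ v₂ v₃ h).1
    obtain ⟨a, hau, hay, ha⟩ := hconn.exists_mem_gInterval_of_dist_eq hwm hmt' hu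
    obtain ⟨b, hbv, hby, hb⟩ := hconn.exists_mem_gInterval_of_dist_eq hwm hmt' hv
    have := hgrid _ (hconn.isoSquareGrid_of_mem_gInterval hwm.2 hx hau hay hbv hby)
    omega
  refine ⟨thin, fun u v x y => ?_⟩
  have h := hconn.four_point_of_thin hmt thin u v x y
  have h' : G.dist u v + G.dist x y ≤
      max (G.dist u x + G.dist v y) (G.dist u y + G.dist v x) + 2 * (32 * κ + 20 * μ) := by
    omega
  exact_mod_cast h'
end

section
/- Let G be a connected weakly modular graph and let ⪯ be a BFS order on its vertex set, i.e. a well-order for which there is a family (A_x)_{x ∈ V(G)} of vertex sets satisfying: (S1) x ∈ A_x for every vertex x; (S2) if x ⪯ y then A_x is an initial segment of A_y with respect to ⪯ (that is, A_x ⊆ A_y and whenever z ∈ A_x, w ∈ A_y and w ⪯ z, then w ∈ A_x); (S3) A_x = A_(x) ∪ N(x), where N(x) is the set of neighbors of x, A_(x) = {x} if x is the least element, and A_(x) = ⋃_{y ≺ x} A_y otherwise. Then ⪯ is distance-preserving: for every vertex v, the subgraph of G induced by {u : u ⪯ v} is an isometric subgraph of G. -/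
variable {V : Type*}

/-- `S` induces an isometric subgraph of `G`. -/
def IsIsometricSubset (G : SimpleGraph V) (S : Set V) : Prop :=
  ∀ x y : S, (G.induce S).dist x y = G.dist (x : V) (y : V)

namespace SimpleGraph

variable {G : SimpleGraph V}

theorem Connected.dist_le_add_one_of_adj (hG : G.Connected) {x y : V} (h : G.Adj x y) (u : V) :
    G.dist u x ≤ G.dist u y + 1 := by
  have := hG.dist_triangle (u := u) (v := y) (w := x)
  rwa [dist_eq_one_iff_adj.2 h.symm] at this

theorem Connected.exists_adj_dist_add_one (hG : G.Connected) {x y : V} (h : x ≠ y) :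
    ∃ z, G.Adj y z ∧ G.dist x z + 1 = G.dist x y := by
  obtain ⟨w, hw⟩ := hG.exists_walk_length_eq_dist y x
  cases w with
  | nil => exact absurd rfl h
  | cons hadj w' =>
    rename_i z
    refine ⟨z, hadj, ?_⟩
    have h1 := dist_le w'
    have h2 := hG.dist_le_add_one_of_adj hadj x
    rw [Walk.length_cons, dist_comm] at hw
    rw [dist_comm] at h1
    omega

theorem Connected.exists_common_neighbor (hG : G.Connected) {x y : V} (h : G.dist x y = 2) :
    ∃ z, G.Adj x z ∧ G.Adj y z := by
  obtain ⟨z, hz, hd⟩ := hG.exists_adj_dist_add_one (x := x) (y := y) (by rintro rfl; simp at h)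
  exact ⟨z, dist_eq_one_iff_adj.1 (by omega), hz⟩

/-- In a weakly modular graph, if `x` is closer to `o` than `y` is, then some neighbor of `y` is
closer than `y` to both `o` and `x`. -/
theorem exists_adj_closer_to_both (hG : G.Connected) (hwm : WeaklyModular G) (o x : V) :
    ∀ k y, G.dist x y = k → G.dist o x < G.dist o y →
      ∃ z, G.Adj y z ∧ G.dist o z + 1 = G.dist o y ∧ G.dist x z + 1 = G.dist x y := by
  intro k
  induction k with
  | zero =>
    intro y hk hlt
    rw [hG.dist_eq_zero_iff] at hk
    subst hk
    omega
  | succ k ih =>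
    intro y hk hlt
    obtain ⟨z, hyz, hxz⟩ := hG.exists_adj_dist_add_one (x := x) (y := y)
      (by rintro rfl; omega)
    have h1 := hG.dist_le_add_one_of_adj hyz o
    have h2 := hG.dist_le_add_one_of_adj hyz.symm o
    rcases (by omega : G.dist o z + 1 = G.dist o y ∨ G.dist o z = G.dist o y ∨
      G.dist o z = G.dist o y + 1) with h | h | h
    · exact ⟨z, hyz, h, hxz⟩
    · obtain ⟨z', hzz', hoz', hxz'⟩ := ih z (by omega) (by omega)
      obtain ⟨c, hyc, hzc, hoc⟩ := hwm.1 o y z hyz h.symm (by omega)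
      have hyz' : G.dist y z' = 2 := by
        have t1 := hG.dist_triangle (u := x) (v := z') (w := y)
        have t2 := hG.dist_le_add_one_of_adj hzz'.symm y
        rw [dist_comm (u := z')] at t1
        rw [dist_eq_one_iff_adj.2 hyz] at t2
        omega
      have t3 := hG.dist_le_add_one_of_adj hzc.symm z'
      rw [dist_eq_one_iff_adj.2 hzz'.symm] at t3
      rcases (by omega : G.dist z' c = 0 ∨ G.dist z' c = 1 ∨ G.dist z' c = 2) with h' | h' | h'
      · rw [hG.dist_eq_zero_iff] at h'
        subst h'
        rw [dist_eq_one_iff_adj.2 hyc] at hyz'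
        omega
      · have t4 := hG.dist_le_add_one_of_adj (dist_eq_one_iff_adj.1 h').symm x
        have t5 := hG.dist_le_add_one_of_adj hyc x
        exact ⟨c, hyc, hoc, by omega⟩
      · obtain ⟨e, hz'e, hce, hoe⟩ := hwm.2 o z' c z hzz' hzc h' (by omega) (by omega)
        have t4 := hG.dist_le_add_one_of_adj hce.symm y
        rw [dist_eq_one_iff_adj.2 hyc] at t4
        have t5 := hG.dist_triangle (u := o) (v := e) (w := y)
        rw [dist_comm (u := e)] at t5
        obtain ⟨t, hz't, het, hyt⟩ := hwm.1 y z' e hz'e (by omega) (by omega)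
        have hyt' : G.Adj y t := dist_eq_one_iff_adj.1 (by omega)
        have t6 := hG.dist_le_add_one_of_adj het.symm o
        have t7 := hG.dist_le_add_one_of_adj hyt' o
        have t8 := hG.dist_le_add_one_of_adj hz't.symm x
        have t9 := hG.dist_le_add_one_of_adj hyt' x
        exact ⟨t, hyt', by omega, by omega⟩
    · obtain ⟨z', hzz', hoz', hxz'⟩ := ih z (by omega) (by omega)
      have hyz' : G.dist y z' = 2 := by
        have t1 := hG.dist_triangle (u := x) (v := z') (w := y)
        have t2 := hG.dist_le_add_one_of_adj hzz'.symm y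
        rw [dist_comm (u := z')] at t1
        rw [dist_eq_one_iff_adj.2 hyz] at t2
        omega
      obtain ⟨t, hyt, hz't, hot⟩ := hwm.2 o y z' z hyz.symm hzz' hyz' (by omega) (by omega)
      have t8 := hG.dist_le_add_one_of_adj hz't.symm x
      have t9 := hG.dist_le_add_one_of_adj hyt x
      exact ⟨t, hyt, hot, by omega⟩

/-- Two vertices at distance two and equidistant from `s` either have a common neighbor closer to
`s`, or span an equilateral metric triangle of side two with a third vertex towards `s`. -/
theorem exists_closer_common_neighbor_or_triangle (hG : G.Connected) (hwm : WeaklyModular G)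
    {s a b : V} (hab : G.dist a b = 2) (hs : G.dist s a = G.dist s b) :
    (∃ g, G.Adj a g ∧ G.Adj b g ∧ G.dist s g + 1 = G.dist s a) ∨
      ∃ t, G.dist s t + 2 = G.dist s a ∧ G.dist a t = 2 ∧ G.dist b t = 2 := by
  obtain ⟨m, ham, hbm⟩ := hG.exists_common_neighbor hab
  have h1 := hG.dist_le_add_one_of_adj ham s
  have h2 := hG.dist_le_add_one_of_adj ham.symm s
  rcases (by omega : G.dist s m + 1 = G.dist s a ∨ G.dist s m = G.dist s a ∨
      G.dist s m = G.dist s a + 1) with h | h | h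
  · exact .inl ⟨m, ham, hbm, h⟩
  · have hpos : 1 ≤ G.dist s a := by
      by_contra h0
      have e1 := hG.dist_eq_zero_iff.1 (by omega : G.dist s a = 0)
      have e2 := hG.dist_eq_zero_iff.1 (by omega : G.dist s b = 0)
      rw [← e1, ← e2, dist_self] at hab
      omega
    obtain ⟨c, hac, hmc, hsc⟩ := hwm.1 s a m ham h.symm hpos
    obtain ⟨c', hbc', hmc', hsc'⟩ := hwm.1 s b m hbm (by omega) (by omega)
    have key : ∀ t, G.Adj c t → G.Adj c' t → G.dist s t + 1 = G.dist s c →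
        ∃ t, G.dist s t + 2 = G.dist s a ∧ G.dist a t = 2 ∧ G.dist b t = 2 := by
      intro t hct hc't hst
      have t1 := hG.dist_le_add_one_of_adj hct.symm a
      have t2 := hG.dist_le_add_one_of_adj hc't.symm b
      rw [dist_eq_one_iff_adj.2 hac] at t1
      rw [dist_eq_one_iff_adj.2 hbc'] at t2
      have t3 := hG.dist_triangle (u := s) (v := t) (w := a)
      have t4 := hG.dist_triangle (u := s) (v := t) (w := b)
      rw [dist_comm (u := t)] at t3 t4
      exact ⟨t, by omega, by omega, by omega⟩
    have t3 := hG.dist_le_add_one_of_adj hmc'.symm c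
    rw [dist_eq_one_iff_adj.2 hmc.symm] at t3
    rcases (by omega : G.dist c c' = 0 ∨ G.dist c c' = 1 ∨ G.dist c c' = 2) with h' | h' | h'
    · rw [hG.dist_eq_zero_iff] at h'
      subst h'
      exact .inl ⟨c, hac, hbc', hsc⟩
    · have hpos' : 1 ≤ G.dist s c := by
        by_contra h0
        have e1 := hG.dist_eq_zero_iff.1 (by omega : G.dist s c = 0)
        have e2 := hG.dist_eq_zero_iff.1 (by omega : G.dist s c' = 0)
        rw [← e1, ← e2, dist_self] at h'
        omega
      obtain ⟨t, hct, hc't, hst⟩ := hwm.1 s c c' (dist_eq_one_iff_adj.1 h') (by omega) hpos'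
      exact .inr (key t hct hc't hst)
    · obtain ⟨t, hct, hc't, hst⟩ := hwm.2 s c c' m hmc hmc' h' (by omega) (by omega)
      exact .inr (key t hct hc't hst)
  · obtain ⟨g, hg⟩ := hwm.2 s a b m ham.symm hbm.symm hab hs h
    exact .inl ⟨g, hg⟩

/-- If `a` and `b` are at distance two, equidistant from `s`, and some neighbor `w` of `s` is closer
than `s` to `a` and farther than `s` from `b`, then `a` and `b` have a common neighbor closer to
`s`. -/
theorem exists_closer_common_neighbor (hG : G.Connected) (hwm : WeaklyModular G) {s w : V}
    (hsw : G.Adj s w) :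
    ∀ j a b, G.dist a b = 2 → G.dist s a = j → G.dist s b = j → G.dist w a + 1 = j →
      G.dist w b = j + 1 → ∃ g, G.Adj a g ∧ G.Adj b g ∧ G.dist s g + 1 = j := by
  intro j
  induction j using Nat.strong_induction_on with
  | _ j ih =>
  intro a b hab hsa hsb hwa hwb
  have hw : ∀ x, G.dist w x ≤ G.dist s x + 1 ∧ G.dist s x ≤ G.dist w x + 1 := by
    intro x
    have t1 := hG.dist_le_add_one_of_adj hsw x
    have t2 := hG.dist_le_add_one_of_adj hsw.symm x
    rw [dist_comm (u := x), dist_comm (u := x)] at t1 t2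
    exact ⟨t2, t1⟩
  rcases exists_closer_common_neighbor_or_triangle hG hwm hab (hsa.trans hsb.symm) with
    ⟨g, hag, hbg, hg⟩ | ⟨t, hst, hat, hbt⟩
  · exact ⟨g, hag, hbg, by omega⟩
  have hwt : G.dist w t + 1 = j := by
    have t1 := hG.dist_triangle (u := w) (v := t) (w := b)
    rw [dist_comm (u := t)] at t1
    have t2 := hw t
    omega
  rcases exists_closer_common_neighbor_or_triangle hG hwm (s := w) hat (by omega) with
    ⟨c, hac, htc, hwc⟩ | ⟨τ, hwτ, haτ, htτ⟩
  · have hbc : G.dist b c = 3 := by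
      have t1 := hG.dist_triangle (u := w) (v := c) (w := b)
      rw [dist_comm (u := c)] at t1
      have t2 := hG.dist_le_add_one_of_adj htc.symm b
      omega
    have hba : G.dist b a = 2 := by rw [dist_comm]; exact hab
    obtain ⟨g, hag, htg, hbg⟩ := hwm.2 b a t c hac.symm htc.symm hat (by omega) (by omega)
    have t1 := hG.dist_le_add_one_of_adj htg.symm s
    have t2 := hG.dist_le_add_one_of_adj hag s
    exact ⟨g, hag, dist_eq_one_iff_adj.1 (by omega), by omega⟩
  · have hsτ : G.dist s τ + 2 = j := by
      have t1 := hG.dist_triangle (u := s) (v := τ) (w := a)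
      rw [dist_comm (u := τ)] at t1
      have t2 := hw τ
      omega
    have hτt : G.dist τ t = 2 := by rw [dist_comm]; exact htτ
    have hba : G.dist b a = 2 := by rw [dist_comm]; exact hab
    obtain ⟨ρ, hτρ, htρ, hsρ⟩ := ih (j - 2) (by omega) τ t hτt (by omega) (by omega)
      (by omega) (by omega)
    obtain ⟨n, han, hτn⟩ := hG.exists_common_neighbor haτ
    have hbρ := hG.dist_le_add_one_of_adj htρ.symm b
    have hbn := hG.dist_le_add_one_of_adj han.symm b
    have hbτ := hG.dist_triangle (u := w) (v := τ) (w := b)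
    rw [dist_comm (u := τ)] at hbτ
    have hbτn := hG.dist_le_add_one_of_adj hτn b
    have hbτρ := hG.dist_le_add_one_of_adj hτρ b
    have hsn := hG.dist_le_add_one_of_adj han s
    have hnρ : G.dist n ρ = 2 := by
      have t1 := hG.dist_le_add_one_of_adj hτρ.symm n
      rw [dist_eq_one_iff_adj.2 hτn.symm] at t1
      have t2 := hG.dist_triangle (u := s) (v := ρ) (w := n)
      rw [dist_comm (u := ρ)] at t2
      omega
    obtain ⟨κ, hnκ, hρκ, hbκ⟩ := hwm.2 b n ρ τ hτn hτρ hnρ (by omega) (by omega)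
    have hsκ := hG.dist_le_add_one_of_adj hρκ.symm s
    have haκ : G.dist a κ = 2 := by
      have t1 := hG.dist_le_add_one_of_adj hnκ.symm a
      rw [dist_eq_one_iff_adj.2 han] at t1
      have t2 := hG.dist_triangle (u := s) (v := κ) (w := a)
      rw [dist_comm (u := κ)] at t2
      omega
    obtain ⟨g, hag, hκg, hbg⟩ := hwm.2 b a κ n han.symm hnκ haκ (by omega) (by omega)
    have t1 := hG.dist_le_add_one_of_adj hκg.symm s
    have t2 := hG.dist_le_add_one_of_adj hag s
    exact ⟨g, hag, dist_eq_one_iff_adj.1 (by omega), by omega⟩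

/-- `p` is the parent map of a BFS ordering of `G` with root `r`. -/
structure IsBFSParent [LinearOrder V] (G : SimpleGraph V) (r : V) (p : V → V) : Prop where
  root_le : ∀ x, r ≤ x
  adj : ∀ x, x ≠ r → G.Adj x (p x)
  root : p r = r
  le_of_adj : ∀ x z, G.Adj x z → p x ≤ z
  mono : Monotone p
  le_self : ∀ x, p x ≤ x

namespace IsBFSParent

variable [LinearOrder V] {r : V} {p : V → V}

theorem dist_iterate_le (h : IsBFSParent G r p) (hG : G.Connected) (n : ℕ) (x : V) :
    G.dist x (p^[n] x) ≤ n := by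
  induction n with
  | zero => simp
  | succ n ih =>
    rw [Function.iterate_succ_apply']
    by_cases hr : p^[n] x = r
    · rw [hr, h.root, ← hr]
      omega
    · have := hG.dist_le_add_one_of_adj (h.adj _ hr).symm x
      omega

theorem iterate_le (h : IsBFSParent G r p) (hG : G.Connected) (n : ℕ) :
    ∀ x z, G.dist x z ≤ n → p^[n] x ≤ z := by
  induction n with
  | zero =>
    intro x z hd
    rw [hG.dist_eq_zero_iff.1 (by omega : G.dist x z = 0)]
    rfl
  | succ n ih =>
    intro x z hd
    rw [Function.iterate_succ_apply']
    by_cases hxz : x = z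
    · exact (h.le_self _).trans (ih x z (by simp [hxz]))
    · obtain ⟨z', hz', hd'⟩ := hG.exists_adj_dist_add_one hxz
      exact (h.mono (ih x z' (by omega))).trans (h.le_of_adj _ _ hz'.symm)

theorem iterate_eq_root_iff (h : IsBFSParent G r p) (hG : G.Connected) (n : ℕ) (x : V) :
    p^[n] x = r ↔ G.dist r x ≤ n := by
  constructor
  · intro hr
    have := h.dist_iterate_le hG n x
    rwa [hr, dist_comm] at this
  · intro hd
    exact le_antisymm (h.iterate_le hG n x r (by rwa [dist_comm])) (h.root_le _)

theorem dist_root_mono (h : IsBFSParent G r p) (hG : G.Connected) {x y : V} (hxy : x ≤ y) :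
    G.dist r x ≤ G.dist r y := by
  rw [← h.iterate_eq_root_iff hG]
  refine le_antisymm ?_ (h.root_le _)
  exact (h.mono.iterate _ hxy).trans_eq ((h.iterate_eq_root_iff hG _ y).2 le_rfl)

theorem dist_root_iterate (h : IsBFSParent G r p) (hG : G.Connected) (x : V) {i : ℕ}
    (hi : i ≤ G.dist r x) : G.dist r (p^[i] x) + i = G.dist r x := by
  have h1 : G.dist r (p^[i] x) ≤ G.dist r x - i := by
    rw [← h.iterate_eq_root_iff hG, ← Function.iterate_add_apply, Nat.sub_add_cancel hi,
      h.iterate_eq_root_iff hG]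
  have h2 := h.dist_iterate_le hG i x
  have h3 := hG.dist_triangle (u := r) (v := p^[i] x) (w := x)
  rw [dist_comm (u := p^[i] x)] at h3
  omega

theorem dist_iterate (h : IsBFSParent G r p) (hG : G.Connected) (x : V) {i : ℕ}
    (hi : i ≤ G.dist r x) : G.dist (p^[i] x) x = i := by
  have h1 := h.dist_root_iterate hG x hi
  have h2 := h.dist_iterate_le hG i x
  have h3 := hG.dist_triangle (u := r) (v := p^[i] x) (w := x)
  rw [dist_comm] at h2
  omega

theorem exists_lt_adj_closer (h : IsBFSParent G r p) (hG : G.Connected) (hwm : WeaklyModular G)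
    {x y : V} (hxy : x < y) :
    ∃ z, z < y ∧ G.Adj y z ∧ G.dist x z + 1 = G.dist x y := by
  have lt_of_level : ∀ z, G.dist r z < G.dist r y → z < y := fun z hz =>
    lt_of_not_ge fun hle => absurd (h.dist_root_mono hG hle) (by omega)
  rcases (h.dist_root_mono hG hxy.le).lt_or_eq with hlev | hlev
  · obtain ⟨z, hyz, hrz, hxz⟩ := exists_adj_closer_to_both hG hwm r x _ y rfl hlev
    exact ⟨z, lt_of_level z (by omega), hyz, hxz⟩
  have hex : ∃ j, p^[j] x = p^[j] y :=
    ⟨G.dist r y, by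
      rw [(h.iterate_eq_root_iff hG _ y).2 le_rfl, (h.iterate_eq_root_iff hG _ x).2 hlev.le]⟩
  classical
  obtain ⟨j, hj, hmin⟩ : ∃ j, p^[j] x = p^[j] y ∧ ∀ i < j, p^[i] x ≠ p^[i] y :=
    ⟨Nat.find hex, Nat.find_spec hex, fun i hi => Nat.find_min hex hi⟩
  have hjL : j ≤ G.dist r y := by
    by_contra hlt
    apply hmin (G.dist r y) (by omega)
    rw [(h.iterate_eq_root_iff hG _ y).2 le_rfl, (h.iterate_eq_root_iff hG _ x).2 hlev.le]
  obtain ⟨i, rfl⟩ : ∃ i, j = i + 1 := by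
    cases j with
    | zero => exact absurd hj hxy.ne
    | succ i => exact ⟨i, rfl⟩
  have hwv : p^[i] x < p^[i] y := lt_of_le_of_ne (h.mono.iterate i hxy.le) (hmin i (by omega))
  have lt_of_near : ∀ z, G.dist (p^[i] x) z ≤ i → z < y := by
    intro z hz
    refine lt_of_not_ge fun hle => ?_
    have t1 := h.iterate_le hG i z (p^[i] x) (by rwa [dist_comm])
    exact absurd (hwv.trans_le (h.mono.iterate i hle)) (not_lt.2 t1)
  have hwx := h.dist_iterate hG x (i := i) (by omega)
  have hsx := h.dist_iterate hG x (i := i + 1) (by omega)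
  have hsy := h.dist_iterate hG y hjL
  have hrs := h.dist_root_iterate hG y hjL
  rw [← hj] at hsy hrs
  have hsw : G.Adj (p^[i + 1] x) (p^[i] x) := by
    rw [Function.iterate_succ_apply']
    refine (h.adj _ fun hr => ?_).symm
    rw [h.iterate_eq_root_iff hG] at hr
    omega
  generalize p^[i + 1] x = s at *
  generalize p^[i] x = w at *
  have lt_of_closer : ∀ z, G.dist s z + 1 = i + 1 → z < y := by
    intro z hz
    have := hG.dist_triangle (u := r) (v := s) (w := z)
    exact lt_of_level z (by omega)
  have hwy : i + 1 ≤ G.dist w y := by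
    by_contra hlt
    exact lt_irrefl _ (lt_of_near y (by omega))
  have hw : ∀ z, G.dist w z ≤ G.dist s z + 1 ∧ G.dist s z ≤ G.dist w z + 1 := by
    intro z
    have t1 := hG.dist_le_add_one_of_adj hsw z
    have t2 := hG.dist_le_add_one_of_adj hsw.symm z
    rw [dist_comm (u := z), dist_comm (u := z)] at t1 t2
    exact ⟨t2, t1⟩
  have hwy' := (hw y).1
  obtain ⟨z, hyz, hwz, hxz⟩ := exists_adj_closer_to_both hG hwm w x _ y rfl (by omega)
  rcases (by omega : G.dist w y = i + 1 ∨ G.dist w y = i + 2) with h1 | h2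
  · exact ⟨z, lt_of_near z (by omega), hyz, hxz⟩
  obtain ⟨a, hza, hwa, hxa⟩ := exists_adj_closer_to_both hG hwm w x _ z rfl (by omega)
  have hay : G.dist a y = 2 := by
    have t1 := hG.dist_triangle (u := x) (v := a) (w := y)
    have t2 := hG.dist_le_add_one_of_adj hyz a
    rw [dist_eq_one_iff_adj.2 hza.symm] at t2
    omega
  obtain ⟨g, hag, hyg, hsg⟩ : ∃ g, G.Adj a g ∧ G.Adj y g ∧ G.dist s g + 1 = i + 1 := by
    have hsa := (hw a).2
    rcases (by omega : G.dist s a = i + 1 ∨ G.dist s a < i + 1) with hsa | hsa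
    · exact exists_closer_common_neighbor hG hwm hsw (i + 1) a y hay hsa hsy (by omega) h2
    · obtain ⟨g, hyg, hsg, hag⟩ := exists_adj_closer_to_both hG hwm s a _ y rfl (by omega)
      exact ⟨g, dist_eq_one_iff_adj.1 (by omega), hyg, by omega⟩
  have t1 := hG.dist_le_add_one_of_adj hag.symm x
  have t2 := hG.dist_le_add_one_of_adj hyg x
  exact ⟨g, lt_of_closer g hsg, hyg, by omega⟩

theorem exists_walk_induce_Iic (h : IsBFSParent G r p) (hG : G.Connected)
    (hwm : WeaklyModular G) (v : V) (n : ℕ) :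
    ∀ x y : Set.Iic v, G.dist (x : V) y = n →
      ∃ q : (G.induce (Set.Iic v)).Walk x y, q.length = n := by
  induction n with
  | zero =>
    intro x y hd
    obtain rfl := Subtype.ext (hG.dist_eq_zero_iff.1 hd)
    exact ⟨.nil, rfl⟩
  | succ n ih =>
    have step : ∀ x y : Set.Iic v, (x : V) < y → G.dist (x : V) y = n + 1 →
        ∃ q : (G.induce (Set.Iic v)).Walk x y, q.length = n + 1 := by
      intro x y hlt hd
      obtain ⟨z, hz, hyz, hxz⟩ := h.exists_lt_adj_closer hG hwm hlt
      obtain ⟨q, hq⟩ := ih x ⟨z, hz.le.trans y.2⟩ (by simp only; omega)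
      have hadj : (G.induce (Set.Iic v)).Adj ⟨z, hz.le.trans y.2⟩ y := hyz.symm
      exact ⟨q.concat hadj, by simp [hq]⟩
    intro x y hd
    rcases lt_trichotomy (x : V) y with hlt | heq | hgt
    · exact step x y hlt hd
    · rw [heq, dist_self] at hd
      omega
    · obtain ⟨q, hq⟩ := step y x hgt (by rwa [dist_comm])
      exact ⟨q.reverse, by simp [hq]⟩

theorem isIsometricSubset_Iic (h : IsBFSParent G r p) (hG : G.Connected)
    (hwm : WeaklyModular G) (v : V) : IsIsometricSubset G (Set.Iic v) := by
  intro x y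
  obtain ⟨q, hq⟩ := h.exists_walk_induce_Iic hG hwm v _ x y rfl
  refine le_antisymm (hq ▸ dist_le q) ?_
  obtain ⟨q', hq'⟩ := q.reachable.exists_walk_length_eq_dist
  rw [← hq', ← Walk.length_map (Embedding.induce (G := G) (Set.Iic v)).toHom q']
  exact dist_le _

end IsBFSParent

theorem exists_isBFSParent [LinearOrder V] [WellFoundedLT V] [Nonempty V] {A : V → Set V}
    (hS1 : ∀ x : V, x ∈ A x)
    (hS2 : ∀ x y : V, x ≤ y → ∀ z ∈ A x, ∀ w ∈ A y, w ≤ z → w ∈ A x)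
    (hS3least : ∀ x : V, (∀ y : V, ¬ y < x) → A x = {x} ∪ G.neighborSet x)
    (hS3 : ∀ x : V, (∃ y : V, y < x) →
      A x = {u : V | ∃ y : V, y < x ∧ u ∈ A y} ∪ G.neighborSet x) :
    ∃ r p, IsBFSParent G r p := by
  obtain ⟨r, -, hr⟩ := wellFounded_lt.has_min (Set.univ : Set V) Set.univ_nonempty
  have hr' : ∀ x, r ≤ x := fun x => not_lt.1 (hr x trivial)
  have hmin : ∀ x, ∃ y, x ∈ A y ∧ ∀ z, x ∈ A z → y ≤ z := by
    intro x
    obtain ⟨y, hy, hy'⟩ := wellFounded_lt.has_min {y | x ∈ A y} ⟨x, hS1 x⟩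
    exact ⟨y, hy, fun z hz => not_lt.1 (hy' z hz)⟩
  choose p hp hple using hmin
  have hnbr : ∀ x z, G.Adj x z → x ∈ A z := by
    intro x z hxz
    by_cases hz : ∃ y, y < z
    · rw [hS3 z hz]
      exact .inr hxz.symm
    · rw [hS3least z (not_exists.1 hz)]
      exact .inr hxz.symm
  refine ⟨r, p, hr', ?_, ?_, fun x z hxz => hple x z (hnbr x z hxz), ?_,
    fun x => hple x x (hS1 x)⟩
  · intro x hx
    have hxp := hp x
    by_cases hz : ∃ y, y < p x
    · rw [hS3 _ hz] at hxp
      rcases hxp with ⟨y, hy, hxy⟩ | hadj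
      · exact absurd (hple x y hxy) (not_le.2 hy)
      · exact hadj.symm
    · have hpr : p x = r := le_antisymm (not_lt.1 fun hlt => hz ⟨r, hlt⟩) (hr' _)
      rw [hS3least _ (not_exists.1 hz)] at hxp
      rcases hxp with heq | hadj
      · exact absurd (heq.trans hpr) hx
      · exact hadj.symm
  · exact le_antisymm (hple r r (hS1 r)) (hr' _)
  · intro x y hxy
    by_contra hlt
    have hlt := not_le.1 hlt
    exact absurd (hple x _ (hS2 _ _ hlt.le y (hp y) x (hp x) hxy)) (not_le.2 hlt)

end SimpleGraph

theorem statement17 (G : SimpleGraph V) (hconn : G.Connected)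
    (hwm : WeaklyModular G)
    (lt : V → V → Prop) (hwo : IsWellOrder V lt) (A : V → Set V)
    (hS1 : ∀ x : V, x ∈ A x)
    (hS2 : ∀ x y : V, (lt x y ∨ x = y) →
      A x ⊆ A y ∧ ∀ z ∈ A x, ∀ w ∈ A y, (lt w z ∨ w = z) → w ∈ A x)
    (hS3least : ∀ x : V, (∀ y : V, ¬ lt y x) →
      A x = {x} ∪ G.neighborSet x)
    (hS3 : ∀ x : V, (∃ y : V, lt y x) →
      A x = {u : V | ∃ y : V, lt y x ∧ u ∈ A y} ∪ G.neighborSet x) :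
    ∀ v : V, IsIsometricSubset G {u : V | lt u v ∨ u = v} := by
  intro v
  classical
  let _ : LinearOrder V := linearOrderOfSTO lt
  have : WellFoundedLT V := ⟨hwo.wf⟩
  have : Nonempty V := ⟨v⟩
  have hle : ∀ x y : V, x ≤ y ↔ lt x y ∨ x = y := fun x y => le_iff_lt_or_eq
  obtain ⟨r, p, h⟩ := SimpleGraph.exists_isBFSParent (G := G) (A := A) hS1
    (fun x y hxy z hz w hw hwz =>
      (hS2 x y ((hle x y).1 hxy)).2 z hz w hw ((hle w z).1 hwz)) hS3least hS3
  have hset : {u : V | lt u v ∨ u = v} = Set.Iic v := Set.ext fun u => (hle u v).symm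
  rw [hset]
  exact h.isIsometricSubset_Iic hconn hwm v
end

section
/- Let G be a connected graph and ⪯ a well-order on its vertex set such that for any two vertices u,w with d(u,w) = 2 there exists a common neighbor v of u and w with v ≺ max{u,w} (the maximum taken with respect to ⪯). Then ⪯ is distance-preserving: for every vertex v, the subgraph of G induced by {u : u ⪯ v} is an isometric subgraph of G. -/
variable {V : Type*}

theorem SimpleGraph.exists_walk_of_forall_adj {W : Type*} (H : SimpleGraph W) (g : ℕ → W)
    (i k : ℕ) (hg : ∀ j, i ≤ j → j < i + k → H.Adj (g j) (g (j + 1))) :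
    ∃ p : H.Walk (g i) (g (i + k)), p.length = k := by
  induction k with
  | zero => exact ⟨.nil, rfl⟩
  | succ k ih =>
    obtain ⟨p, hp⟩ := ih fun j h1 h2 => hg j h1 (by omega)
    exact ⟨p.concat (hg (i + k) (by omega) (by omega)), by simp [hp]⟩

theorem SimpleGraph.Connected.dist_eq_of_forall_adj {G : SimpleGraph V} (hconn : G.Connected)
    {f : ℕ → V} {n : ℕ} (hf : ∀ j < n, G.Adj (f j) (f (j + 1)))
    (hn : G.dist (f 0) (f n) = n) {i k : ℕ} (hik : i + k ≤ n) :
    G.dist (f i) (f (i + k)) = k := by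
  have hle : ∀ i k, i + k ≤ n → G.dist (f i) (f (i + k)) ≤ k := by
    intro i k hik
    obtain ⟨p, hp⟩ := G.exists_walk_of_forall_adj f i k fun j _ h2 => hf j (by omega)
    exact (SimpleGraph.dist_le p).trans hp.le
  have h1 := hle 0 i (by omega)
  have h2 := hle i k hik
  have h3 := hle (i + k) (n - (i + k)) (by omega)
  rw [Nat.add_sub_cancel' hik] at h3
  rw [Nat.zero_add] at h1
  have t1 := hconn.dist_triangle (u := f 0) (v := f i) (w := f n)
  have t2 := hconn.dist_triangle (u := f i) (v := f (i + k)) (w := f n)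
  omega

/-- A geodesic with an interior maximum can be lowered until it stays below any common upper
bound of its endpoints. -/
theorem SimpleGraph.Connected.exists_geodesic_le [LinearOrder V] [WellFoundedLT V]
    {G : SimpleGraph V} (hconn : G.Connected)
    (h : ∀ u w : V, G.dist u w = 2 → ∃ c, G.Adj u c ∧ G.Adj w c ∧ c < max u w)
    {v : V} {n : ℕ} (m : V) (f : ℕ → V) (h0 : f 0 ≤ v) (hv : f n ≤ v)
    (hf : ∀ j < n, G.Adj (f j) (f (j + 1))) (hn : G.dist (f 0) (f n) = n)
    (hm : ∃ i ≤ n, f i = m ∧ ∀ j ≤ n, f j ≤ m) :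
    ∃ g : ℕ → V, g 0 = f 0 ∧ g n = f n ∧ (∀ j < n, G.Adj (g j) (g (j + 1))) ∧
      ∀ j ≤ n, g j ≤ v := by
  induction m using WellFoundedLT.induction generalizing f with
  | ind m ih =>
  obtain ⟨i, hi, rfl, hmax⟩ := hm
  rcases le_or_gt (f i) v with hiv | hiv
  · exact ⟨f, rfl, rfl, hf, fun j hj => (hmax j hj).trans hiv⟩
  have hi0 : i ≠ 0 := by rintro rfl; exact absurd h0 hiv.not_ge
  have hin : i ≠ n := by rintro rfl; exact absurd hv hiv.not_ge
  obtain ⟨i, rfl⟩ := Nat.exists_eq_succ_of_ne_zero hi0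
  have hlt : ∀ j ≤ n, j ≠ i + 1 → f j < f (i + 1) := by
    intro j hj hne
    refine lt_of_le_of_ne (hmax j hj) fun heq => ?_
    rcases le_total j (i + 1) with hji | hji
    · have := hconn.dist_eq_of_forall_adj hf hn (i := j) (k := i + 1 - j) (by omega)
      rw [Nat.add_sub_cancel' hji, heq, SimpleGraph.dist_self] at this
      omega
    · have := hconn.dist_eq_of_forall_adj hf hn (i := i + 1) (k := j - (i + 1)) (by omega)
      rw [Nat.add_sub_cancel' hji, heq, SimpleGraph.dist_self] at this
      omega
  obtain ⟨c, hc1, hc2, hc⟩ := h (f i) (f (i + 2))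
    (hconn.dist_eq_of_forall_adj hf hn (by omega))
  have hcm : c < f (i + 1) :=
    hc.trans (max_lt (hlt i (by omega) (by omega)) (hlt (i + 2) (by omega) (by omega)))
  let g := Function.update f (i + 1) c
  have hgc : g (i + 1) = c := Function.update_self ..
  have hgf : ∀ j, j ≠ i + 1 → g j = f j := fun j hj => Function.update_of_ne hj ..
  have hg0 : g 0 = f 0 := hgf 0 (by omega)
  have hgn : g n = f n := hgf n (by omega)
  have hg : ∀ j < n, G.Adj (g j) (g (j + 1)) := by
    intro j hj
    rcases eq_or_ne j i with rfl | hji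
    · rwa [hgc, hgf j (by omega)]
    rcases eq_or_ne j (i + 1) with rfl | hji'
    · rw [hgc, hgf (i + 1 + 1) (by omega)]
      exact hc2.symm
    · rw [hgf j hji', hgf (j + 1) (by omega)]
      exact hf j hj
  obtain ⟨k, hk, hkmax⟩ := (Finset.range (n + 1)).exists_max_image g ⟨0, by simp⟩
  simp only [Finset.mem_range, Nat.lt_succ_iff] at hk hkmax
  have hgk : g k < f (i + 1) := by
    rcases eq_or_ne k (i + 1) with rfl | hki
    · rwa [hgc]
    · rw [hgf k hki]
      exact hlt k hk hki
  simpa only [hg0, hgn] using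
    ih (g k) hgk g (by rwa [hg0]) (by rwa [hgn]) hg (by rwa [hg0, hgn]) ⟨k, hk, rfl, hkmax⟩

theorem SimpleGraph.Connected.isIsometricSubset_Iic [LinearOrder V] [WellFoundedLT V]
    {G : SimpleGraph V} (hconn : G.Connected)
    (h : ∀ u w : V, G.dist u w = 2 → ∃ c, G.Adj u c ∧ G.Adj w c ∧ c < max u w) (v : V) :
    IsIsometricSubset G (Set.Iic v) := by
  rintro ⟨x, hx⟩ ⟨y, hy⟩
  obtain ⟨p, hp⟩ := hconn.exists_walk_length_eq_dist x y
  obtain ⟨k, hk, hkmax⟩ :=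
    (Finset.range (p.length + 1)).exists_max_image p.getVert ⟨0, by simp⟩
  simp only [Finset.mem_range, Nat.lt_succ_iff] at hk hkmax
  obtain ⟨g, hg0, hgn, hg, hgv⟩ := hconn.exists_geodesic_le h (v := v) (n := p.length)
    (p.getVert k) p.getVert (by simpa using hx) (by simpa using hy)
    (fun j hj => p.adj_getVert_succ hj) (by rw [p.getVert_zero, p.getVert_length, hp]) ⟨k, hk, rfl, hkmax⟩
  rw [p.getVert_zero] at hg0
  rw [p.getVert_length] at hgn
  let s : ℕ → Set.Iic v := fun j => ⟨g (min j p.length), hgv _ (min_le_right _ _)⟩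
  obtain ⟨q', hq'⟩ := (G.induce (Set.Iic v)).exists_walk_of_forall_adj s 0 p.length fun j _ hj => by
    have hj' : j < p.length := by omega
    simpa [s, hj'.le, Nat.succ_le_of_lt hj'] using hg j hj'
  have hs0 : s 0 = ⟨x, hx⟩ := by simp [s, hg0]
  have hsn : s (0 + p.length) = ⟨y, hy⟩ := by simp [s, hgn]
  obtain ⟨q, hq⟩ : ∃ q : (G.induce (Set.Iic v)).Walk ⟨x, hx⟩ ⟨y, hy⟩, q.length = p.length :=
    ⟨q'.copy hs0 hsn, by simpa using hq'⟩
  apply le_antisymm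
  · exact (SimpleGraph.dist_le q).trans (hq.trans hp).le
  · obtain ⟨r, hr⟩ := q.reachable.exists_walk_length_eq_dist
    rw [← hr, ← r.length_map (SimpleGraph.Embedding.induce _).toHom]
    exact SimpleGraph.dist_le _

theorem statement18 (G : SimpleGraph V) (hconn : G.Connected)
    (lt : V → V → Prop) (hwo : IsWellOrder V lt)
    (h : ∀ u w : V, G.dist u w = 2 →
      ∃ v : V, G.Adj u v ∧ G.Adj w v ∧
        (lt u w → lt v w) ∧ (lt w u → lt v u)) :
    ∀ v : V, IsIsometricSubset G {u : V | lt u v ∨ u = v} := by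
  classical
  let : LinearOrder V := linearOrderOfSTO lt
  have : WellFoundedLT V := ⟨hwo.wf⟩
  intro v
  have hset : {u : V | lt u v ∨ u = v} = Set.Iic v := by
    ext u
    exact (le_iff_lt_or_eq (a := u) (b := v)).symm
  rw [hset]
  refine hconn.isIsometricSubset_Iic (fun u w huw => ?_) v
  obtain ⟨c, hu, hw, h1, h2⟩ := h u w huw
  refine ⟨c, hu, hw, ?_⟩
  have hne : u ≠ w := by rintro rfl; simp at huw
  rcases lt_or_gt_of_ne hne with hlt | hlt
  · exact lt_max_of_lt_right (h1 hlt)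
  · exact lt_max_of_lt_left (h2 hlt)
end
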